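/- Let n ≥ 3 and m ∈ ℕ. Suppose a, b ∈ ℝ are such that (∫_{S^{n-1}} |u|^{2(n-1)/(n-2)} dμ_{S^{n-1}})^{(n-2)/(n-1)} ≤ a ∫_{𝔹ⁿ} |∇u|² dx + b ∫_{S^{n-1}} u² dμ_{S^{n-1}} holds for every u ∈ H¹(𝔹ⁿ) satisfying ∫_{S^{n-1}} p |u|^{2(n-1)/(n-2)} dμ_{S^{n-1}} = 0 for all p ∈ P̊_m. Then a ≥ c(n, n/(n-2)) / Θ(m, (n-2)/(n-1), n-1), where c(n, n/(n-2)) = (2/(n-2)) |S^{n-1}|^{-1/(n-1)}. -/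

import Mathlib

open MeasureTheory Metric Filter
open scoped ENNReal RealInnerProductSpace

noncomputable section

abbrev E (n : ℕ) : Type := EuclideanSpace ℝ (Fin n)

/-- The standard surface measure on the unit sphere `S^{n-1}`, as a Borel measure on `ℝⁿ`. -/
def sphMeasure (n : ℕ) : Measure (E n) :=
  Measure.map Subtype.val ((volume : Measure (E n)).toSphere)

/-- `|S^{n-1}|` : the total mass of the surface measure. -/
def SA (n : ℕ) : ℝ := (sphMeasure n Set.univ).toReal

/-- `P̊_m` : polynomials of degree at most `m` with zero mean on the sphere. -/
def P0 (n m : ℕ) : Set (MvPolynomial (Fin n) ℝ) :=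
  {p | p.totalDegree ≤ m ∧ ∫ x, MvPolynomial.eval (fun i => x i) p ∂(sphMeasure n) = 0}

/-- `Θ(m, θ, n-1)` : the infimum of `Σ_i ν_iᶿ` over all probability measures
`ν = Σ_i ν_i δ_{ξ_i}` on `S^{n-1}` supported on countably many points such that
`∫ p dν = 0` for all `p ∈ P̊_m`. -/
def Theta (n m : ℕ) (θ : ℝ) : ℝ :=
  sInf {t : ℝ | ∃ (ξ : ℕ → E n) (w : ℕ → ℝ),
    (∀ i, ξ i ∈ Metric.sphere (0 : E n) 1) ∧ (∀ i, 0 ≤ w i) ∧ Summable w ∧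
    (∑' i, w i) = 1 ∧
    (∀ p ∈ P0 n m, (∑' i, w i * MvPolynomial.eval (fun j => ξ i j) p) = 0) ∧
    Summable (fun i => w i ^ θ) ∧ t = ∑' i, w i ^ θ}

lemma sph_ae (n : ℕ) : ∀ᵐ x ∂(sphMeasure n), ‖x‖ = 1 := by
  rw [sphMeasure, ae_map_iff measurable_subtype_coe.aemeasurable
    (measurableSet_eq_fun measurable_norm measurable_const)]
  refine Eventually.of_forall fun x => ?_
  simp

instance (n : ℕ) : IsFiniteMeasure (sphMeasure n) := by
  unfold sphMeasure; infer_instance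

lemma SA_pos (n : ℕ) (hn : 3 ≤ n) : 0 < SA n := by
  unfold SA
  apply ENNReal.toReal_pos
  · rw [sphMeasure, Measure.map_apply measurable_subtype_coe MeasurableSet.univ]
    simp only [Set.preimage_univ, Measure.toSphere_apply_univ]
    have h1 : volume (ball (0 : E n) 1) ≠ 0 := (measure_ball_pos _ _ one_pos).ne'
    have h2 : (n : ℝ≥0∞) ≠ 0 := by
      simp; omega
    simp [h1]; omega
  · exact measure_ne_top _ _

lemma SA_eq (n : ℕ) : SA n = (sphMeasure n).real Set.univ := rfl

/-- Polar coordinates for the lower Lebesgue integral. -/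
lemma polar (n : ℕ) (hn : 3 ≤ n) (f : E n → ℝ≥0∞) (hf : Measurable f) :
    ∫⁻ x, f x = ∫⁻ s in Set.Ioi (0 : ℝ), ENNReal.ofReal (s ^ (n - 1)) *
      ∫⁻ x, f (s • x) ∂(sphMeasure n) := by
  haveI : Nontrivial (E n) := by
    haveI : Nonempty (Fin n) := ⟨⟨0, by omega⟩⟩
    infer_instance
  have hd : Module.finrank ℝ (E n) = n := by simp
  calc ∫⁻ x, f x = ∫⁻ x : ({(0 : E n)}ᶜ : Set (E n)), f x.1 ∂((volume : Measure (E n)).comap (↑)) := by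
        rw [lintegral_subtype_comap (measurableSet_singleton _).compl,
        restrict_compl_singleton]
    _ = ∫⁻ x, f (x.2.1 • x.1.1) ∂((volume : Measure (E n)).toSphere.prod (.volumeIoiPow (Module.finrank ℝ (E n) - 1))) := by
      rw [← (volume : Measure (E n)).measurePreserving_homeomorphUnitSphereProd.lintegral_comp_emb
        (Homeomorph.measurableEmbedding _)]
      refine lintegral_congr fun x => ?_
      have hx : ‖x.1‖ ≠ 0 := norm_ne_zero_iff.2 x.2
      simp [smul_smul, hx]
    _ = ∫⁻ s : Set.Ioi (0:ℝ), ∫⁻ x, f (s.1 • x.1) ∂((volume : Measure (E n)).toSphere) ∂(.volumeIoiPow (Module.finrank ℝ (E n) - 1)) := by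
      rw [lintegral_prod_symm]
      exact Measurable.aemeasurable (hf.comp (by fun_prop))
    _ = ∫⁻ s : Set.Ioi (0:ℝ), ∫⁻ x, f (s.1 • x) ∂(sphMeasure n) ∂(.volumeIoiPow (n - 1)) := by
      rw [hd]
      refine lintegral_congr fun s => ?_
      rw [sphMeasure, lintegral_map (by fun_prop) measurable_subtype_coe]
    _ = _ := by
      rw [Measure.volumeIoiPow, lintegral_withDensity_eq_lintegral_mul _ (by fun_prop)]
      · simp only [Pi.mul_apply]
        rw [lintegral_subtype_comap measurableSet_Ioi (fun s : ℝ => ENNReal.ofReal (s ^ (n - 1)) *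
          ∫⁻ x, f (s • x) ∂(sphMeasure n))]
      · have : Measurable fun s : ℝ => ∫⁻ x, f (s • x) ∂(sphMeasure n) :=
          Measurable.lintegral_prod_right' (f := fun p : ℝ × E n => f (p.1 • p.2)) (by fun_prop)
        exact this.comp measurable_subtype_coe


/-- Spatial part of the Lorentz boost of `(‖x‖, x)` in direction `ξ`. -/
def boost {n : ℕ} (A B : ℝ) (ξ x : E n) : E n := x + ((A - 1) * ⟪ξ, x⟫ + B * ‖x‖) • ξ

lemma boost_inner {n : ℕ} (A B : ℝ) (ξ x : E n) (hξ : ‖ξ‖ = 1) :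
    ⟪ξ, boost A B ξ x⟫ = A * ⟪ξ, x⟫ + B * ‖x‖ := by
  simp only [boost, inner_add_right, inner_smul_right, real_inner_self_eq_norm_sq, hξ]
  ring

lemma boost_aux {n : ℕ} (A B : ℝ) (hA : 1 ≤ A) (hAB : A ^ 2 - B ^ 2 = 1) (ξ x : E n)
    (hξ : ‖ξ‖ = 1) (hx : x ≠ 0) : 0 < A * ‖x‖ + B * ⟪ξ, x⟫ := by
  have h1 : |⟪ξ, x⟫| ≤ ‖x‖ := by simpa [hξ] using abs_real_inner_le_norm ξ x
  have hx' : 0 < ‖x‖ := norm_pos_iff.2 hx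
  have h2 : |B| < A := abs_lt_of_sq_lt_sq (by linarith) (by linarith)
  have h3 : |B * ⟪ξ, x⟫| ≤ |B| * ‖x‖ := by
    rw [abs_mul]; gcongr
  have h4 : |B| * ‖x‖ < A * ‖x‖ := by gcongr
  linarith [neg_abs_le (B * ⟪ξ, x⟫)]

lemma boost_norm {n : ℕ} (A B : ℝ) (hA : 1 ≤ A) (hAB : A ^ 2 - B ^ 2 = 1) (ξ x : E n)
    (hξ : ‖ξ‖ = 1) : ‖boost A B ξ x‖ = A * ‖x‖ + B * ⟪ξ, x⟫ := by
  have h0 : 0 ≤ A * ‖x‖ + B * ⟪ξ, x⟫ := by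
    by_cases hx : x = 0
    · simp [hx]
    · exact (boost_aux A B hA hAB ξ x hξ hx).le
  rw [← sq_eq_sq₀ (norm_nonneg _) h0]
  rw [boost, norm_add_sq_real, norm_smul, hξ, inner_smul_right, real_inner_comm, mul_one,
    Real.norm_eq_abs, sq_abs]
  have : B ^ 2 = A ^ 2 - 1 := by linarith
  ring_nf
  rw [this]
  ring

lemma boost_inv {n : ℕ} (A B : ℝ) (hA : 1 ≤ A) (hAB : A ^ 2 - B ^ 2 = 1) (ξ x : E n)
    (hξ : ‖ξ‖ = 1) : boost A (-B) ξ (boost A B ξ x) = x := by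
  have h1 := boost_inner A B ξ x hξ
  have h2 := boost_norm A B hA hAB ξ x hξ
  rw [boost, h1, h2]
  rw [boost, add_assoc, ← add_smul]
  have : ((A - 1) * ⟪ξ, x⟫ + B * ‖x‖ + ((A - 1) * (A * ⟪ξ, x⟫ + B * ‖x‖) + -B * (A * ‖x‖ + B * ⟪ξ, x⟫))) = 0 := by
    have : B ^ 2 = A ^ 2 - 1 := by linarith
    ring_nf
    rw [this]
    ring
  rw [this]; simp

lemma hasFDerivAt_norm' {n : ℕ} (x : E n) (hx : x ≠ 0) :
    HasFDerivAt (fun y : E n => ‖y‖) (‖x‖⁻¹ • innerSL ℝ x) x := by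
  have h1 := (hasStrictFDerivAt_norm_sq x).hasFDerivAt.sqrt (by simpa using hx)
  have h2 : (fun y : E n => Real.sqrt (‖y‖ ^ 2)) = fun y => ‖y‖ := by
    ext y; exact Real.sqrt_sq (norm_nonneg _)
  rw [h2] at h1
  have h3 : (1 / (2 * Real.sqrt (‖x‖ ^ 2))) • (2 • innerSL ℝ x) = ‖x‖⁻¹ • innerSL ℝ x := by
    rw [Real.sqrt_sq (norm_nonneg _)]
    ext v
    simp
    field_simp
  rw [← h3]
  exact h1

/-- The derivative of the boost. -/
def boostD {n : ℕ} (A B : ℝ) (ξ x : E n) : E n →L[ℝ] E n :=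
  ContinuousLinearMap.id ℝ (E n) +
    ((A - 1) • innerSL ℝ ξ + B • (‖x‖⁻¹ • innerSL ℝ x)).smulRight ξ

lemma boost_deriv {n : ℕ} (A B : ℝ) (ξ x : E n) (hx : x ≠ 0) :
    HasFDerivAt (boost A B ξ) (boostD A B ξ x) x := by
  unfold boost boostD
  refine (hasFDerivAt_id x).add (HasFDerivAt.smul_const (HasFDerivAt.add ?_ ?_) ξ)
  · exact ((innerSL ℝ ξ).hasFDerivAt (x := x)).const_mul (A - 1)
  · exact (hasFDerivAt_norm' x hx).const_mul B

lemma boost_det {n : ℕ} (A B : ℝ) (ξ x : E n) (hξ : ‖ξ‖ = 1) (hx : x ≠ 0) :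
    (boostD A B ξ x).det = (A * ‖x‖ + B * ⟪ξ, x⟫) / ‖x‖ := by
  have : ((boostD A B ξ x : E n →L[ℝ] E n) : E n →ₗ[ℝ] E n) = LinearMap.transvection
      ((((A - 1) • innerSL ℝ ξ + B • (‖x‖⁻¹ • innerSL ℝ x) : E n →L[ℝ] ℝ)) : E n →ₗ[ℝ] ℝ) ξ := by
    ext v
    simp [boostD, LinearMap.transvection]
  rw [ContinuousLinearMap.det, this, LinearMap.transvection.det]
  have hx' : ‖x‖ ≠ 0 := norm_ne_zero_iff.2 hx
  simp [hξ]
  rw [real_inner_comm]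
  field_simp
  ring

lemma gamma_lint (n : ℕ) (hn : 3 ≤ n) (κ : ℝ) (hκ : 0 < κ) :
    ∫⁻ s in Set.Ioi (0 : ℝ), ENNReal.ofReal (s ^ (n - 2) * Real.exp (-(κ * s))) =
      ENNReal.ofReal (Real.Gamma (n - 1)) * ENNReal.ofReal ((κ ^ (n - 1))⁻¹) := by
  have hn' : (3 : ℝ) ≤ n := by exact_mod_cast hn
  have h := Real.integral_rpow_mul_exp_neg_mul_Ioi (a := (n : ℝ) - 1) (r := κ) (by linarith) hκ
  have hG : 0 < Real.Gamma ((n : ℝ) - 1) := Real.Gamma_pos_of_pos (by linarith)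
  have e1 : ∀ s ∈ Set.Ioi (0 : ℝ), s ^ ((n : ℝ) - 1 - 1) * Real.exp (-(κ * s)) =
      s ^ (n - 2) * Real.exp (-(κ * s)) := by
    intro s hs
    rw [← Real.rpow_natCast, Nat.cast_sub (by omega)]
    norm_num
    congr 1; ring
  rw [setIntegral_congr_fun measurableSet_Ioi e1] at h
  have e2 : (1 / κ) ^ ((n : ℝ) - 1) = (κ ^ (n - 1))⁻¹ := by
    rw [one_div, Real.inv_rpow hκ.le, ← Real.rpow_natCast, Nat.cast_sub (by omega)]
    norm_num
  rw [e2] at h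
  rw [← ofReal_integral_eq_lintegral_ofReal, h, mul_comm, ENNReal.ofReal_mul hG.le]
  · by_contra hc
    rw [integral_undef hc] at h
    have : 0 < (κ ^ (n - 1))⁻¹ * Real.Gamma ((n : ℝ) - 1) := by positivity
    linarith
  · filter_upwards [ae_restrict_mem measurableSet_Ioi] with s hs
    have : 0 < s := hs
    positivity

lemma polar_exp (n : ℕ) (hn : 3 ≤ n) (A B : ℝ) (hA : 1 ≤ A) (hAB : A ^ 2 - B ^ 2 = 1) (ξ : E n)
    (hξ : ‖ξ‖ = 1) :
    ∫⁻ x : E n, ENNReal.ofReal (Real.exp (-(A * ‖x‖ + B * ⟪ξ, x⟫)) / ‖x‖) =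
      ENNReal.ofReal (Real.Gamma (n - 1)) *
        ∫⁻ x, ENNReal.ofReal (((A + B * ⟪ξ, x⟫) ^ (n - 1))⁻¹) ∂(sphMeasure n) := by
  rw [polar n hn _ (by fun_prop)]
  have e1 : ∀ s ∈ Set.Ioi (0 : ℝ), ENNReal.ofReal (s ^ (n - 1)) *
      ∫⁻ x, ENNReal.ofReal (Real.exp (-(A * ‖s • x‖ + B * ⟪ξ, s • x⟫)) / ‖s • x‖) ∂(sphMeasure n) =
      ∫⁻ x, ENNReal.ofReal (s ^ (n - 2) * Real.exp (-((A + B * ⟪ξ, x⟫) * s))) ∂(sphMeasure n) := by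
    intro s hs
    have hs : 0 < s := hs
    rw [← lintegral_const_mul _ (by fun_prop)]
    apply lintegral_congr_ae
    filter_upwards [sph_ae n] with x hx
    rw [← ENNReal.ofReal_mul (by positivity)]
    congr 1
    rw [norm_smul, hx, inner_smul_right, Real.norm_eq_abs, abs_of_pos hs]
    have : n - 1 = (n - 2) + 1 := by omega
    rw [this, pow_succ]
    field_simp
  rw [setLIntegral_congr_fun measurableSet_Ioi e1]
  rw [lintegral_lintegral_swap]
  · rw [← lintegral_const_mul _ (by fun_prop)]
    apply lintegral_congr_ae
    filter_upwards [sph_ae n] with x hx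
    have hx0 : x ≠ 0 := by rintro rfl; simp at hx
    have := boost_aux A B hA hAB ξ x hξ hx0
    rw [hx, mul_one] at this
    exact gamma_lint n hn _ this
  · exact Measurable.aemeasurable (by fun_prop)

lemma boost_sphere (n : ℕ) (hn : 3 ≤ n) (A B : ℝ) (hA : 1 ≤ A) (hAB : A ^ 2 - B ^ 2 = 1) (ξ : E n)
    (hξ : ‖ξ‖ = 1) :
    ∫⁻ x, ENNReal.ofReal (((A + B * ⟪ξ, x⟫) ^ (n - 1))⁻¹) ∂(sphMeasure n) =
      sphMeasure n Set.univ := by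
  have : Nontrivial (E n) := ⟨ξ, 0, by rintro rfl; simp at hξ⟩
  have hn' : (3 : ℝ) ≤ n := by exact_mod_cast hn
  have hG : 0 < Real.Gamma ((n : ℝ) - 1) := Real.Gamma_pos_of_pos (by linarith)
  have h1 := polar_exp n hn A B hA hAB ξ hξ
  have h2 := polar_exp n hn 1 0 le_rfl (by norm_num) ξ hξ
  have hAB' : A ^ 2 - (-B) ^ 2 = 1 := by rw [neg_sq]; exact hAB
  have hne : ∀ (B : ℝ), A ^ 2 - B ^ 2 = 1 → ∀ x : E n, x ≠ 0 → boost A B ξ x ≠ 0 := by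
    intro B hAB x hx
    rw [← norm_ne_zero_iff, boost_norm A B hA hAB ξ x hξ]
    exact (boost_aux A B hA hAB ξ x hξ hx).ne'
  have himg : boost A B ξ '' {0}ᶜ = {0}ᶜ := by
    ext y
    constructor
    · rintro ⟨x, hx, rfl⟩
      exact hne B hAB x hx
    · intro hy
      refine ⟨boost A (-B) ξ y, hne (-B) hAB' y hy, ?_⟩
      have := boost_inv A (-B) hA hAB' ξ y hξ
      rwa [neg_neg] at this
  have hcov := lintegral_image_eq_lintegral_abs_det_fderiv_mul volume
    (s := ({0}ᶜ : Set (E n))) (measurableSet_singleton _).compl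
    (fun x hx => (boost_deriv A B ξ x hx).hasFDerivWithinAt)
    (fun x _ y _ hxy => by
      rw [← boost_inv A B hA hAB ξ x hξ, ← boost_inv A B hA hAB ξ y hξ, hxy])
    (fun y => ENNReal.ofReal (Real.exp (-(1 * ‖y‖ + 0 * ⟪ξ, y⟫)) / ‖y‖))
  rw [himg] at hcov
  have e : ∀ x ∈ ({0}ᶜ : Set (E n)), ENNReal.ofReal |(boostD A B ξ x).det| *
      ENNReal.ofReal (Real.exp (-(1 * ‖boost A B ξ x‖ + 0 * ⟪ξ, boost A B ξ x⟫)) / ‖boost A B ξ x‖) =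
      ENNReal.ofReal (Real.exp (-(A * ‖x‖ + B * ⟪ξ, x⟫)) / ‖x‖) := by
    intro x hx
    have hp := boost_aux A B hA hAB ξ x hξ hx
    have hx' : 0 < ‖x‖ := norm_pos_iff.2 hx
    rw [boost_norm A B hA hAB ξ x hξ, boost_det A B ξ x hξ hx, abs_of_pos (by positivity),
      ← ENNReal.ofReal_mul (by positivity)]
    congr 1
    simp only [one_mul, zero_mul, add_zero]
    field_simp
  rw [setLIntegral_congr_fun (measurableSet_singleton _).compl e, restrict_compl_singleton, h1,
    h2] at hcov
  have h3 := (ENNReal.mul_right_inj (a := ENNReal.ofReal (Real.Gamma (n - 1)))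
    (by simpa using hG) (by simp)).1 hcov
  rw [← h3]
  simp

lemma dist_sq_sphere {n : ℕ} (r : ℝ) (ξ x : E n) (hξ : ‖ξ‖ = 1) (hx : ‖x‖ = 1) :
    ‖x - r • ξ‖ ^ 2 = 1 + r ^ 2 - 2 * r * ⟪ξ, x⟫ := by
  rw [norm_sub_sq_real, norm_smul, hξ, hx, inner_smul_right, real_inner_comm, mul_one,
    Real.norm_eq_abs, sq_abs]
  ring

/-- The total mass of the conformal factor. -/
lemma sphere_lint (n : ℕ) (hn : 3 ≤ n) (r : ℝ) (hr : 1 < r) (ξ : E n) (hξ : ‖ξ‖ = 1) :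
    ∫⁻ x, ENNReal.ofReal (((‖x - r • ξ‖ ^ 2) ^ (n - 1))⁻¹) ∂(sphMeasure n) =
      ENNReal.ofReal (SA n * ((r ^ 2 - 1) ^ (n - 1))⁻¹) := by
  have hr2 : 0 < r ^ 2 - 1 := by nlinarith
  have h := boost_sphere n hn ((1 + r ^ 2) / (r ^ 2 - 1)) (-(2 * r) / (r ^ 2 - 1))
    (by rw [le_div_iff₀ hr2]; linarith) (by field_simp; ring) ξ hξ
  have e : ∀ᵐ x ∂(sphMeasure n), ENNReal.ofReal (((‖x - r • ξ‖ ^ 2) ^ (n - 1))⁻¹) =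
      ENNReal.ofReal (((r ^ 2 - 1) ^ (n - 1))⁻¹) *
      ENNReal.ofReal ((((1 + r ^ 2) / (r ^ 2 - 1) + -(2 * r) / (r ^ 2 - 1) * ⟪ξ, x⟫) ^ (n - 1))⁻¹) := by
    filter_upwards [sph_ae n] with x hx
    rw [← ENNReal.ofReal_mul (by positivity), dist_sq_sphere r ξ x hξ hx, ← mul_inv, ← mul_pow]
    congr 3
    field_simp
    ring
  rw [lintegral_congr_ae e, lintegral_const_mul _ (by fun_prop), h, SA, mul_comm,
    ENNReal.ofReal_mul (by positivity), ENNReal.ofReal_toReal (measure_ne_top _ _)]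


/-- The unnormalized bubble. -/
def bub {n : ℕ} (r : ℝ) (ξ x : E n) : ℝ := ((‖x - r • ξ‖ ^ 2) ^ (n - 1))⁻¹

lemma bub_nonneg {n : ℕ} (r : ℝ) (ξ x : E n) : 0 ≤ bub r ξ x := by unfold bub; positivity

lemma bub_meas {n : ℕ} (r : ℝ) (ξ : E n) : Measurable (bub r ξ) := by unfold bub; fun_prop

lemma bub_sphere_integrable (n : ℕ) (hn : 3 ≤ n) (r : ℝ) (hr : 1 < r) (ξ : E n) (hξ : ‖ξ‖ = 1) :
    Integrable (bub r ξ) (sphMeasure n) := by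
  refine ⟨(bub_meas r ξ).aestronglyMeasurable, ?_⟩
  rw [hasFiniteIntegral_iff_ofReal (Eventually.of_forall fun x => bub_nonneg r ξ x)]
  have := sphere_lint n hn r hr ξ hξ
  unfold bub
  rw [this]
  exact ENNReal.ofReal_lt_top

lemma bub_sphere_integral (n : ℕ) (hn : 3 ≤ n) (r : ℝ) (hr : 1 < r) (ξ : E n) (hξ : ‖ξ‖ = 1) :
    ∫ x, bub r ξ x ∂(sphMeasure n) = SA n * ((r ^ 2 - 1) ^ (n - 1))⁻¹ := by
  have hS := SA_pos n hn
  have hr2 : 0 < r ^ 2 - 1 := by nlinarith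
  rw [integral_eq_lintegral_of_nonneg_ae (Eventually.of_forall fun x => bub_nonneg r ξ x)
    (bub_meas r ξ).aestronglyMeasurable]
  unfold bub
  rw [sphere_lint n hn r hr ξ hξ, ENNReal.toReal_ofReal (by positivity)]

lemma radial_integral (k : ℕ) (r : ℝ) (hr : 1 < r) :
    ∫⁻ s in Set.Ioo (0 : ℝ) 1, ENNReal.ofReal (s * ((r ^ 2 - s ^ 2) ^ (k + 2))⁻¹) ≤
      ENNReal.ofReal ((2 * ((k : ℝ) + 1))⁻¹ * ((r ^ 2 - 1) ^ (k + 1))⁻¹) := by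
  have hpos : ∀ s ∈ Set.Icc (0 : ℝ) 1, 0 < r ^ 2 - s ^ 2 := by
    intro s hs
    nlinarith [hs.1, hs.2]
  have hc : ContinuousOn (fun s : ℝ => s * ((r ^ 2 - s ^ 2) ^ (k + 2))⁻¹) (Set.Icc 0 1) := by
    apply ContinuousOn.mul continuousOn_id
    apply ContinuousOn.inv₀ (by fun_prop)
    intro s hs
    exact (pow_pos (hpos s hs) _).ne'
  have hd : ∀ s ∈ Set.uIcc (0 : ℝ) 1,
      HasDerivAt (fun s : ℝ => (2 * ((k : ℝ) + 1))⁻¹ * ((r ^ 2 - s ^ 2) ^ (k + 1))⁻¹)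
        (s * ((r ^ 2 - s ^ 2) ^ (k + 2))⁻¹) s := by
    intro s hs
    rw [Set.uIcc_of_le zero_le_one] at hs
    have hp := hpos s hs
    have h1 : HasDerivAt (fun s : ℝ => r ^ 2 - s ^ 2) (-(2 * s)) s := by
      simpa using (hasDerivAt_pow 2 s).const_sub (r ^ 2)
    have h2 := ((h1.pow (k + 1)).inv (pow_pos hp _).ne').const_mul ((2 * ((k : ℝ) + 1))⁻¹)
    refine h2.congr_deriv ?_
    simp only [Nat.add_sub_cancel]
    push_cast
    have hk : (k : ℝ) + 1 ≠ 0 := by positivity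
    field_simp
    simp only [Pi.pow_apply]
    ring
  have hintg := intervalIntegral.integral_eq_sub_of_hasDerivAt hd
    (by apply ContinuousOn.intervalIntegrable; rwa [Set.uIcc_of_le zero_le_one])
  rw [intervalIntegral.integral_of_le zero_le_one] at hintg
  rw [Measure.restrict_congr_set Ioo_ae_eq_Ioc, ← ofReal_integral_eq_lintegral_ofReal]
  · rw [hintg]
    apply ENNReal.ofReal_le_ofReal
    have : 0 ≤ (2 * ((k : ℝ) + 1))⁻¹ * ((r ^ 2 - 0 ^ 2) ^ (k + 1))⁻¹ := by
      have := hpos 0 (by simp)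
      positivity
    simp only [one_pow]
    linarith
  · exact (hc.integrableOn_Icc).mono_set Set.Ioc_subset_Icc_self
  · filter_upwards [ae_restrict_mem measurableSet_Ioc] with s hs
    have := hpos s ⟨hs.1.le, hs.2⟩
    have := hs.1
    positivity

lemma ball_lint (n : ℕ) (hn : 3 ≤ n) (r : ℝ) (hr : 1 < r) (ξ : E n) (hξ : ‖ξ‖ = 1) :
    ∫⁻ x in ball (0 : E n) 1, ENNReal.ofReal (bub r ξ x) ≤
      ENNReal.ofReal (SA n * ((2 * ((n : ℝ) - 2))⁻¹ * ((r ^ 2 - 1) ^ (n - 2))⁻¹)) := by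
  have hS := SA_pos n hn
  rw [← lintegral_indicator measurableSet_ball, polar n hn _
    (Measurable.indicator (bub_meas r ξ).ennreal_ofReal measurableSet_ball)]
  have e1 : ∀ s ∈ Set.Ioi (0 : ℝ), ENNReal.ofReal (s ^ (n - 1)) *
      ∫⁻ x, (ball (0 : E n) 1).indicator (fun x => ENNReal.ofReal (bub r ξ x)) (s • x)
        ∂(sphMeasure n) ≤
      (Set.Ioo (0 : ℝ) 1).indicator (fun s => ENNReal.ofReal (SA n) *
        ENNReal.ofReal (s * ((r ^ 2 - s ^ 2) ^ (n - 1))⁻¹)) s := by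
    intro s hs
    have hs : 0 < s := hs
    by_cases h1 : s < 1
    · rw [Set.indicator_of_mem (show s ∈ Set.Ioo (0 : ℝ) 1 from ⟨hs, h1⟩)]
      have e2 : ∀ᵐ x ∂(sphMeasure n),
          (ball (0 : E n) 1).indicator (fun x => ENNReal.ofReal (bub r ξ x)) (s • x) =
          ENNReal.ofReal (((s ^ 2) ^ (n - 1))⁻¹) *
            ENNReal.ofReal (((‖x - (r / s) • ξ‖ ^ 2) ^ (n - 1))⁻¹) := by
        filter_upwards [sph_ae n] with x hx
        have hsx : ‖s • x‖ = s := by rw [norm_smul, hx, Real.norm_eq_abs, abs_of_pos hs, mul_one]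
        rw [Set.indicator_of_mem (by simpa [hsx] using h1), ← ENNReal.ofReal_mul (by positivity)]
        congr 1
        rw [bub, ← mul_inv, ← mul_pow, ← mul_pow]
        have : s • x - r • ξ = s • (x - (r / s) • ξ) := by
          rw [smul_sub, smul_smul, mul_div_cancel₀ _ hs.ne']
        rw [this, norm_smul, Real.norm_eq_abs, abs_of_pos hs]
      have hrs : 1 < r / s := by rw [lt_div_iff₀ hs]; linarith
      rw [lintegral_congr_ae e2, lintegral_const_mul _ (by fun_prop), sphere_lint n hn _ hrs ξ hξ,
        ← ENNReal.ofReal_mul (by positivity), ← ENNReal.ofReal_mul (by positivity),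
        ← ENNReal.ofReal_mul (by positivity)]
      apply ENNReal.ofReal_le_ofReal
      have hq : 0 < r ^ 2 - s ^ 2 := by nlinarith
      have e3 : ((s ^ 2) ^ (n - 1))⁻¹ * (SA n * (((r / s) ^ 2 - 1) ^ (n - 1))⁻¹) =
          SA n * ((r ^ 2 - s ^ 2) ^ (n - 1))⁻¹ := by
        rw [mul_left_comm, ← mul_inv, ← mul_pow]
        congr 3
        field_simp
      rw [e3]
      have e4 : s ^ (n - 1) ≤ s := by
        calc s ^ (n - 1) ≤ s ^ 1 := pow_le_pow_of_le_one hs.le h1.le (by omega)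
          _ = s := pow_one s
      calc _ ≤ s * (SA n * ((r ^ 2 - s ^ 2) ^ (n - 1))⁻¹) := by gcongr
        _ = _ := by ring
    · have e2 : ∀ᵐ x ∂(sphMeasure n),
          (ball (0 : E n) 1).indicator (fun x => ENNReal.ofReal (bub r ξ x)) (s • x) = 0 := by
        filter_upwards [sph_ae n] with x hx
        have hsx : ‖s • x‖ = s := by rw [norm_smul, hx, Real.norm_eq_abs, abs_of_pos hs, mul_one]
        rw [Set.indicator_of_notMem (by simpa [hsx] using h1)]
      rw [lintegral_congr_ae e2]
      simp
  refine (setLIntegral_mono' measurableSet_Ioi e1).trans ?_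
  rw [setLIntegral_indicator measurableSet_Ioo, lintegral_const_mul' _ _ ENNReal.ofReal_ne_top,
    ENNReal.ofReal_mul hS.le]
  gcongr
  obtain ⟨k, rfl⟩ : ∃ k, n = k + 3 := ⟨n - 3, by omega⟩
  have hset : Set.Ioo (0 : ℝ) 1 ∩ Set.Ioi 0 = Set.Ioo 0 1 := by
    ext; simp; tauto
  rw [hset]
  have := radial_integral k r hr
  have e5 : ((k + 3 : ℕ) : ℝ) - 2 = k + 1 := by push_cast; ring
  rw [e5]
  exact this

lemma bub_ball_integrable (n : ℕ) (hn : 3 ≤ n) (r : ℝ) (hr : 1 < r) (ξ : E n) (hξ : ‖ξ‖ = 1) :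
    IntegrableOn (bub r ξ) (ball (0 : E n) 1) := by
  refine ⟨(bub_meas r ξ).aestronglyMeasurable, ?_⟩
  rw [hasFiniteIntegral_iff_ofReal (Eventually.of_forall fun x => bub_nonneg r ξ x)]
  exact (ball_lint n hn r hr ξ hξ).trans_lt ENNReal.ofReal_lt_top

lemma bub_ball_integral (n : ℕ) (hn : 3 ≤ n) (r : ℝ) (hr : 1 < r) (ξ : E n) (hξ : ‖ξ‖ = 1) :
    ∫ x in ball (0 : E n) 1, bub r ξ x ≤
      SA n * ((2 * ((n : ℝ) - 2))⁻¹ * ((r ^ 2 - 1) ^ (n - 2))⁻¹) := by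
  have hS := SA_pos n hn
  have hn' : (3 : ℝ) ≤ n := by exact_mod_cast hn
  have hr2 : 0 < r ^ 2 - 1 := by nlinarith
  have hn2 : 0 < (n : ℝ) - 2 := by linarith
  rw [integral_eq_lintegral_of_nonneg_ae (Eventually.of_forall fun x => bub_nonneg r ξ x)
    (bub_meas r ξ).aestronglyMeasurable]
  exact ENNReal.toReal_le_of_le_ofReal (by positivity) (ball_lint n hn r hr ξ hξ)

/-- The normalized bubble. -/
def phi {n : ℕ} (r : ℝ) (ξ x : E n) : ℝ := (SA n)⁻¹ * (r ^ 2 - 1) ^ (n - 1) * bub r ξ x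

lemma SA_nonneg (n : ℕ) : 0 ≤ SA n := ENNReal.toReal_nonneg

lemma phi_nonneg {n : ℕ} (r : ℝ) (hr : 1 < r) (ξ x : E n) : 0 ≤ phi r ξ x := by
  have h1 : 0 < r ^ 2 - 1 := by nlinarith
  have := bub_nonneg r ξ x
  have := SA_nonneg n
  unfold phi; positivity

lemma phi_integrable (n : ℕ) (hn : 3 ≤ n) (r : ℝ) (hr : 1 < r) (ξ : E n) (hξ : ‖ξ‖ = 1) :
    Integrable (phi r ξ) (sphMeasure n) := (bub_sphere_integrable n hn r hr ξ hξ).const_mul _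

lemma phi_integral (n : ℕ) (hn : 3 ≤ n) (r : ℝ) (hr : 1 < r) (ξ : E n) (hξ : ‖ξ‖ = 1) :
    ∫ x, phi r ξ x ∂(sphMeasure n) = 1 := by
  have hr2 : 0 < r ^ 2 - 1 := by nlinarith
  have hS := SA_pos n hn
  unfold phi
  rw [integral_const_mul, bub_sphere_integral n hn r hr ξ hξ]
  field_simp

lemma phi_le {n : ℕ} (r δ : ℝ) (hr : 1 < r) (hδ : 0 < δ) (ξ x : E n) (hξ : ‖ξ‖ = 1)
    (hx : ‖x‖ = 1) (hxδ : δ ≤ ‖x - ξ‖) :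
    phi r ξ x ≤ (SA n)⁻¹ * (r ^ 2 - 1) ^ (n - 1) * ((δ ^ 2) ^ (n - 1))⁻¹ := by
  have h1 : 0 < r ^ 2 - 1 := by nlinarith
  have hS := SA_nonneg n
  have h2 : δ ^ 2 ≤ ‖x - r • ξ‖ ^ 2 := by
    have e1 := dist_sq_sphere r ξ x hξ hx
    have e2 := dist_sq_sphere 1 ξ x hξ hx
    rw [one_smul] at e2
    have e3 : δ ^ 2 ≤ ‖x - ξ‖ ^ 2 := by gcongr
    nlinarith [sq_nonneg (r - 1), sq_nonneg δ]
  unfold phi bub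
  gcongr

lemma phi_bound_tendsto (n : ℕ) (hn : 3 ≤ n) (c : ℝ) :
    Tendsto (fun r : ℝ => (SA n)⁻¹ * (r ^ 2 - 1) ^ (n - 1) * c) (nhdsWithin 1 (Set.Ioi 1))
      (nhds 0) := by
  have : Continuous (fun r : ℝ => (SA n)⁻¹ * (r ^ 2 - 1) ^ (n - 1) * c) := by fun_prop
  have h := this.tendsto 1
  have e : (SA n)⁻¹ * ((1 : ℝ) ^ 2 - 1) ^ (n - 1) * c = 0 := by
    have : n - 1 ≠ 0 := by omega
    simp [this]
  rw [e] at h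
  exact h.mono_left nhdsWithin_le_nhds

lemma phi_conc (n : ℕ) (hn : 3 ≤ n) (ξ : E n) (hξ : ‖ξ‖ = 1) (p : E n → ℝ) (hp : Continuous p) :
    Tendsto (fun r : ℝ => ∫ x, p x * phi r ξ x ∂(sphMeasure n)) (nhdsWithin 1 (Set.Ioi 1))
      (nhds (p ξ)) := by
  have hrest : (sphMeasure n).restrict (sphere 0 1) = sphMeasure n := by
    apply Measure.restrict_eq_self_of_ae_mem
    filter_upwards [sph_ae n] with x hx
    simpa using hx
  have hintg : IntegrableOn p (sphere 0 1) (sphMeasure n) :=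
    hp.continuousOn.integrableOn_compact (isCompact_sphere _ _)
  have h := tendsto_setIntegral_peak_smul_of_integrableOn_of_tendsto
    (μ := sphMeasure n) (s := sphere (0 : E n) 1) (t := sphere (0 : E n) 1) (x₀ := ξ) (g := p)
    (a := p ξ) (φ := fun r x => phi r ξ x) (l := nhdsWithin 1 (Set.Ioi 1))
    isClosed_sphere.measurableSet isClosed_sphere.measurableSet subset_rfl
    self_mem_nhdsWithin (measure_ne_top _ _) ?_ ?_ ?_ ?_ hintg
    (hp.continuousWithinAt)
  · rw [hrest] at h
    refine h.congr fun r => integral_congr_ae (Eventually.of_forall fun x => ?_)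
    simp [mul_comm]
  · filter_upwards [self_mem_nhdsWithin] with r hr x _
    exact phi_nonneg r hr ξ x
  · intro u hu hξu
    obtain ⟨δ, hδ, hb⟩ := Metric.isOpen_iff.1 hu ξ hξu
    rw [Metric.tendstoUniformlyOn_iff]
    intro ε hε
    filter_upwards [self_mem_nhdsWithin,
      (phi_bound_tendsto n hn (((δ ^ 2) ^ (n - 1))⁻¹)).eventually (gt_mem_nhds hε)] with r hr hr2 x hx
    have hx1 : ‖x‖ = 1 := by simpa using hx.1
    have hxd : δ ≤ ‖x - ξ‖ := by
      by_contra hc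
      exact hx.2 (hb (by rw [mem_ball, dist_eq_norm]; exact not_le.1 hc))
    have := phi_le r δ hr hδ ξ x hξ hx1 hxd
    rw [Pi.zero_apply, dist_zero_left, Real.norm_eq_abs, abs_of_nonneg (phi_nonneg r hr ξ x)]
    linarith
  · rw [hrest]
    refine tendsto_const_nhds.congr' ?_
    filter_upwards [self_mem_nhdsWithin] with r hr
    rw [phi_integral n hn r hr ξ hξ]
  · filter_upwards with r
    have : Measurable (phi r ξ) := (bub_meas r ξ).const_mul _
    exact this.aestronglyMeasurable

lemma sph_singleton (n : ℕ) (hn : 3 ≤ n) (ξ : E n) (hξ : ‖ξ‖ = 1) : sphMeasure n {ξ} = 0 := by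
  have hS := SA_pos n hn
  have key : ∀ r : ℝ, 1 < r → (sphMeasure n).real {ξ} ≤ SA n * (r - 1) := by
    intro r hr
    have hr1 : 0 < r - 1 := by linarith
    have h1 : (SA n)⁻¹ * (1 / (r - 1)) ≤ phi r ξ ξ := by
      have e : ‖ξ - r • ξ‖ = r - 1 := by
        have : ξ - r • ξ = (1 - r) • ξ := by rw [sub_smul, one_smul]
        rw [this, norm_smul, hξ, Real.norm_eq_abs, abs_of_neg (by linarith)]; ring
      rw [phi, bub, e, mul_assoc, ← div_eq_mul_inv, ← div_pow]
      gcongr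
      have e2 : (r ^ 2 - 1) / (r - 1) ^ 2 = (r + 1) / (r - 1) := by
        field_simp; ring
      rw [e2]
      have h3 : 1 ≤ (r + 1) / (r - 1) := by rw [le_div_iff₀ hr1]; linarith
      calc 1 / (r - 1) ≤ (r + 1) / (r - 1) := by gcongr; linarith
        _ = ((r + 1) / (r - 1)) ^ 1 := (pow_one _).symm
        _ ≤ _ := pow_le_pow_right₀ h3 (by omega)
    have h2 := mul_meas_ge_le_integral_of_nonneg (μ := sphMeasure n)
      (Eventually.of_forall fun x => phi_nonneg r hr ξ x) (phi_integrable n hn r hr ξ hξ)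
      ((SA n)⁻¹ * (1 / (r - 1)))
    rw [phi_integral n hn r hr ξ hξ] at h2
    have h3 : (sphMeasure n).real {ξ} ≤ (sphMeasure n).real {x | (SA n)⁻¹ * (1 / (r - 1)) ≤ phi r ξ x} := by
      apply measureReal_mono
      · rintro x rfl; exact h1
      · exact measure_ne_top _ _
    have h4 : (SA n)⁻¹ * (1 / (r - 1)) * (sphMeasure n).real {ξ} ≤ 1 :=
      (mul_le_mul_of_nonneg_left h3 (by positivity)).trans h2
    have h5 : (SA n)⁻¹ * (1 / (r - 1)) * (sphMeasure n).real {ξ} =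
      (sphMeasure n).real {ξ} / (SA n * (r - 1)) := by field_simp
    rw [h5, div_le_one (by positivity)] at h4
    exact h4
  have h0 : (sphMeasure n).real {ξ} ≤ 0 := by
    apply le_of_forall_pos_le_add
    intro ε hε
    have := key (1 + ε / SA n) (by have : 0 < ε / SA n := by positivity
                                   linarith)
    have e : SA n * (1 + ε / SA n - 1) = ε := by field_simp; ring
    linarith
  have h1 : (sphMeasure n).real {ξ} = 0 := le_antisymm h0 measureReal_nonneg
  rwa [measureReal_def, ENNReal.toReal_eq_zero_iff, or_iff_left (measure_ne_top _ _)] at h1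

lemma phi_meas {n : ℕ} (r : ℝ) (ξ : E n) : Measurable (phi r ξ) := (bub_meas r ξ).const_mul _

lemma rpow_split (t K θ : ℝ) (ht : 0 ≤ t) (hK : 0 < K) (hθ : 0 < θ) (hθ1 : θ < 1) :
    t ^ θ ≤ K ^ (θ - 1) * t + (min t K) ^ θ := by
  rcases le_total t K with h | h
  · rw [min_eq_left h]
    have : 0 ≤ K ^ (θ - 1) * t := by positivity
    linarith
  · rw [min_eq_right h]
    have htp : 0 < t := lt_of_lt_of_le hK h
    have e : t ^ θ = t ^ (θ - 1) * t := by
      rw [← Real.rpow_add_one htp.ne']; ring_nf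
    have : t ^ (θ - 1) ≤ K ^ (θ - 1) := Real.rpow_le_rpow_of_nonpos hK h (by linarith)
    have h2 : 0 ≤ K ^ θ := by positivity
    rw [e]
    nlinarith

lemma phi_rpow_integrable (n : ℕ) (hn : 3 ≤ n) (ξ : E n) (hξ : ‖ξ‖ = 1) (r : ℝ) (hr : 1 < r)
    (θ : ℝ) (hθ : 0 < θ) (hθ1 : θ < 1) :
    Integrable (fun x => phi r ξ x ^ θ) (sphMeasure n) := by
  refine Integrable.mono' ((integrable_const (1 : ℝ)).add (phi_integrable n hn r hr ξ hξ))
    ((phi_meas r ξ).pow_const θ).aestronglyMeasurable (Eventually.of_forall fun x => ?_)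
  have h0 := phi_nonneg r hr ξ x
  rw [Real.norm_eq_abs, abs_of_nonneg (by positivity)]
  have h := rpow_split (phi r ξ x) 1 θ h0 one_pos hθ hθ1
  have h2 : (min (phi r ξ x) 1) ^ θ ≤ 1 :=
    Real.rpow_le_one (by positivity) (min_le_right _ _) hθ.le
  simp only [Real.one_rpow, one_mul] at h
  simp only [Pi.add_apply]
  linarith

lemma phi_L2 (n : ℕ) (hn : 3 ≤ n) (ξ : E n) (hξ : ‖ξ‖ = 1) (θ : ℝ) (hθ : 0 < θ) (hθ1 : θ < 1) :
    Tendsto (fun r : ℝ => ∫ x, phi r ξ x ^ θ ∂(sphMeasure n)) (nhdsWithin 1 (Set.Ioi 1))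
      (nhds 0) := by
  have hDCT : ∀ K : ℝ, 0 < K → Tendsto (fun r : ℝ => ∫ x, (min (phi r ξ x) K) ^ θ ∂(sphMeasure n))
      (nhdsWithin 1 (Set.Ioi 1)) (nhds 0) := by
    intro K hK
    have h := tendsto_integral_filter_of_dominated_convergence (μ := sphMeasure n)
      (l := nhdsWithin (1 : ℝ) (Set.Ioi 1)) (F := fun r x => (min (phi r ξ x) K) ^ θ)
      (f := fun _ => (0 : ℝ)) (fun _ => K ^ θ) ?_ ?_ (integrable_const _) ?_
    · simpa using h
    · filter_upwards with r
      exact (((phi_meas r ξ).min measurable_const).pow_const θ).aestronglyMeasurable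
    · filter_upwards [self_mem_nhdsWithin] with r hr
      filter_upwards with x
      have h0 := phi_nonneg r hr ξ x
      rw [Real.norm_eq_abs, abs_of_nonneg (by positivity)]
      gcongr
      exact min_le_right _ _
    · have hne : ∀ᵐ x ∂(sphMeasure n), x ≠ ξ := by
        rw [ae_iff]; simpa using sph_singleton n hn ξ hξ
      filter_upwards [sph_ae n, hne] with x hx hxξ
      have hδ : 0 < ‖x - ξ‖ := norm_pos_iff.2 (sub_ne_zero.2 hxξ)
      have h1 : Tendsto (fun r => phi r ξ x) (nhdsWithin (1 : ℝ) (Set.Ioi 1)) (nhds 0) := by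
        refine tendsto_of_tendsto_of_tendsto_of_le_of_le' tendsto_const_nhds
          (phi_bound_tendsto n hn (((‖x - ξ‖ ^ 2) ^ (n - 1))⁻¹)) ?_ ?_
        · filter_upwards [self_mem_nhdsWithin] with r hr using phi_nonneg r hr ξ x
        · filter_upwards [self_mem_nhdsWithin] with r hr using
            phi_le r _ hr hδ ξ x hξ hx le_rfl
      have h2 : Tendsto (fun r => min (phi r ξ x) K) (nhdsWithin (1 : ℝ) (Set.Ioi 1)) (nhds 0) := by
        have := h1.min (tendsto_const_nhds (x := K))
        rwa [min_eq_left hK.le] at this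
      have h3 := h2.rpow_const (p := θ) (Or.inr hθ.le)
      rwa [Real.zero_rpow hθ.ne'] at h3
  rw [Metric.tendsto_nhds]
  intro ε hε
  have hK : ∃ K : ℝ, 0 < K ∧ K ^ (θ - 1) < ε / 2 := by
    have := (tendsto_rpow_neg_atTop (y := 1 - θ) (by linarith)).eventually
      (gt_mem_nhds (half_pos hε))
    obtain ⟨K, h1, h2⟩ := (this.and (eventually_gt_atTop 0)).exists
    exact ⟨K, h2, by rwa [neg_sub] at h1⟩
  obtain ⟨K, hK, hKε⟩ := hK
  filter_upwards [self_mem_nhdsWithin, (hDCT K hK).eventually (gt_mem_nhds (half_pos hε))]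
    with r hr hr2
  have hnn : 0 ≤ ∫ x, phi r ξ x ^ θ ∂(sphMeasure n) :=
    integral_nonneg fun x => by have := phi_nonneg r hr ξ x; positivity
  rw [Real.dist_eq, sub_zero, abs_of_nonneg hnn]
  have hmin : Integrable (fun x => (min (phi r ξ x) K) ^ θ) (sphMeasure n) := by
    refine Integrable.mono' (integrable_const (K ^ θ))
      (((phi_meas r ξ).min measurable_const).pow_const θ).aestronglyMeasurable
      (Eventually.of_forall fun x => ?_)
    have h0 := phi_nonneg r hr ξ x
    rw [Real.norm_eq_abs, abs_of_nonneg (by positivity)]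
    gcongr
    exact min_le_right _ _
  have hphi := phi_integrable n hn r hr ξ hξ
  calc ∫ x, phi r ξ x ^ θ ∂(sphMeasure n)
      ≤ ∫ x, (K ^ (θ - 1) * phi r ξ x + (min (phi r ξ x) K) ^ θ) ∂(sphMeasure n) := by
        refine integral_mono (phi_rpow_integrable n hn ξ hξ r hr θ hθ hθ1)
          ((hphi.const_mul _).add hmin) fun x => ?_
        exact rpow_split _ K θ (phi_nonneg r hr ξ x) hK hθ hθ1
    _ = K ^ (θ - 1) + ∫ x, (min (phi r ξ x) K) ^ θ ∂(sphMeasure n) := by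
        rw [integral_add (hphi.const_mul _) hmin, integral_const_mul, phi_integral n hn r hr ξ hξ,
          mul_one]
    _ < ε := by linarith


/-- Evaluation of a polynomial. -/
def ev {n : ℕ} (p : MvPolynomial (Fin n) ℝ) (x : E n) : ℝ := MvPolynomial.eval (fun i => x i) p

lemma ev_contDiff {n : ℕ} (p : MvPolynomial (Fin n) ℝ) : ContDiff ℝ (⊤ : ℕ∞) (ev p) := by
  unfold ev
  induction p using MvPolynomial.induction_on with
  | C a => simpa using contDiff_const
  | add p q hp hq => simpa using hp.add hq
  | mul_X p i hp =>
    have : ContDiff ℝ (⊤ : ℕ∞) (fun x : E n => x i) := by fun_prop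
    simpa using hp.mul this

lemma ev_cont {n : ℕ} (p : MvPolynomial (Fin n) ℝ) : Continuous (ev p) := (ev_contDiff p).continuous

lemma memLp_of_cont {n : ℕ} (f : E n → ℝ) (hf : Continuous f) (q : ℝ≥0∞) :
    MemLp f q (sphMeasure n) := by
  obtain ⟨C, hC⟩ := (isCompact_sphere (0 : E n) 1).exists_bound_of_continuousOn hf.continuousOn
  refine MemLp.of_bound hf.aestronglyMeasurable C ?_
  filter_upwards [sph_ae n] with x hx
  exact hC x (by simpa using hx)

lemma int_of_cont {n : ℕ} (f : E n → ℝ) (hf : Continuous f) : Integrable f (sphMeasure n) :=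
  memLp_one_iff_integrable.1 (memLp_of_cont f hf 1)

/-- `P0` as a submodule. -/
def P0sub (n m : ℕ) : Submodule ℝ (MvPolynomial (Fin n) ℝ) where
  carrier := P0 n m
  add_mem' := by
    intro p q hp hq
    refine ⟨(MvPolynomial.totalDegree_add p q).trans (max_le hp.1 hq.1), ?_⟩
    have h1 := int_of_cont _ (ev_cont p)
    have h2 := int_of_cont _ (ev_cont q)
    have := integral_add h1 h2
    simp only [ev] at this
    simp only [map_add]
    rw [this, hp.2, hq.2, add_zero]
  zero_mem' := by simp [P0]
  smul_mem' := by
    intro c p hp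
    refine ⟨(MvPolynomial.totalDegree_smul_le c p).trans hp.1, ?_⟩
    simp only [MvPolynomial.smul_eval]
    rw [integral_const_mul, hp.2, mul_zero]

instance (n m : ℕ) : FiniteDimensional ℝ (P0sub n m) := by
  have hle : P0sub n m ≤ MvPolynomial.restrictTotalDegree (Fin n) ℝ m := by
    intro p hp
    rw [MvPolynomial.mem_restrictTotalDegree]
    exact hp.1
  exact Module.Finite.of_injective (Submodule.inclusion hle) (Submodule.inclusion_injective hle)

/-- The map to `L²`. -/
def toL2 (n m : ℕ) : P0sub n m →ₗ[ℝ] Lp ℝ 2 (sphMeasure n) where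
  toFun p := (memLp_of_cont (ev p.1) (ev_cont p.1) 2).toLp
  map_add' p q := by
    rw [← MemLp.toLp_add]
    apply MemLp.toLp_congr
    refine Eventually.of_forall fun x => ?_
    simp [ev]
  map_smul' c p := by
    rw [RingHom.id_apply, ← MemLp.toLp_const_smul]
    apply MemLp.toLp_congr
    refine Eventually.of_forall fun x => ?_
    simp [ev, MvPolynomial.smul_eval]

lemma toL2_inner (n m : ℕ) (p : P0sub n m) (f : E n → ℝ) (hf : MemLp f 2 (sphMeasure n)) :
    ⟪toL2 n m p, hf.toLp f⟫ = ∫ x, ev p.1 x * f x ∂(sphMeasure n) := by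
  rw [L2.inner_def]
  apply integral_congr_ae
  filter_upwards [hf.coeFn_toLp, (memLp_of_cont (ev p.1) (ev_cont p.1) 2).coeFn_toLp] with x h1 h2
  have h3 : (toL2 n m p : E n → ℝ) x = ev p.1 x := h2
  rw [h1, h3]
  simp [mul_comm]

lemma gram (n m : ℕ) : ∃ (K : ℕ) (P : Fin K → MvPolynomial (Fin n) ℝ), (∀ k, P k ∈ P0 n m) ∧
    ∀ f : E n → ℝ, MemLp f 2 (sphMeasure n) → ∀ p ∈ P0 n m,
      ∫ x, ev p x * f x ∂(sphMeasure n) =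
        ∑ k, (∫ x, ev (P k) x * f x ∂(sphMeasure n)) *
          ∫ x, ev p x * ev (P k) x ∂(sphMeasure n) := by
  let V := LinearMap.range (toL2 n m)
  let b := stdOrthonormalBasis ℝ V
  have hb : ∀ k, ∃ P : P0sub n m, toL2 n m P = b k := fun k => (b k).2
  choose P hP using hb
  refine ⟨_, fun k => (P k).1, fun k => (P k).2, ?_⟩
  intro f hf p hp
  let p' : P0sub n m := ⟨p, hp⟩
  let v : V := ⟨toL2 n m p', ⟨p', rfl⟩⟩
  have h1 := b.sum_repr' v
  have h2 : toL2 n m p' = ∑ k, ⟪toL2 n m (P k), toL2 n m p'⟫ • toL2 n m (P k) := by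
    have := congrArg (Subtype.val) h1
    rw [Submodule.coe_sum] at this
    simp only [Submodule.coe_smul, Submodule.coe_inner] at this
    simp only [hP]
    exact this.symm
  have h3 : ⟪toL2 n m p', hf.toLp f⟫ = ∑ k, ⟪toL2 n m p', toL2 n m (P k)⟫ * ⟪toL2 n m (P k), hf.toLp f⟫ := by
    conv_lhs => rw [h2]
    rw [sum_inner]
    refine Finset.sum_congr rfl fun k _ => ?_
    rw [real_inner_smul_left, real_inner_comm]
  rw [toL2_inner] at h3
  rw [h3]
  refine Finset.sum_congr rfl fun k _ => ?_
  have h4 := toL2_inner n m p' (ev (P k).1) (memLp_of_cont (ev (P k).1) (ev_cont (P k).1) 2)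
  have h5 : (memLp_of_cont (ev (P k).1) (ev_cont (P k).1) 2).toLp = toL2 n m (P k) := rfl
  rw [h5] at h4
  rw [h4, toL2_inner, mul_comm]

lemma compact_hull {d : ℕ} (s : Set (Fin d → ℝ)) (hs : IsCompact s) : IsCompact (convexHull ℝ s) := by
  let Φ : (Fin (d + 1) → ℝ) × (Fin (d + 1) → (Fin d → ℝ)) → (Fin d → ℝ) := fun q => ∑ i, q.1 i • q.2 i
  have hΦ : Continuous Φ := by fun_prop
  have hK : IsCompact (stdSimplex ℝ (Fin (d + 1)) ×ˢ (Set.univ.pi fun _ : Fin (d + 1) => s)) :=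
    (isCompact_stdSimplex ℝ _).prod (isCompact_univ_pi fun _ => hs)
  have himg := hK.image hΦ
  convert himg using 1
  ext x
  constructor
  · intro hx
    obtain ⟨ι, _, z, w, hz, hai, hw, hw1, hwz⟩ := eq_pos_convex_span_of_mem_convexHull hx
    have hcard : Fintype.card ι ≤ d + 1 := by
      have h1 := hai.card_le_finrank_succ
      have h2 : Module.finrank ℝ (vectorSpan ℝ (Set.range z)) ≤ d := by
        have := Submodule.finrank_le (vectorSpan ℝ (Set.range z))
        simpa using this
      omega
    have hne : Nonempty ι := by
      by_contra hc
      rw [not_nonempty_iff] at hc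
      simp at hw1
    obtain ⟨f⟩ : Nonempty (ι ↪ Fin (d + 1)) := Function.Embedding.nonempty_of_card_le (by simpa using hcard)
    obtain ⟨i0⟩ := hne
    refine ⟨(Function.extend f w 0, Function.extend f z (fun _ => z i0)), ⟨⟨?_, ?_⟩, ?_⟩, ?_⟩
    · intro j
      by_cases hj : ∃ i, f i = j
      · obtain ⟨i, rfl⟩ := hj
        simp only [f.injective.extend_apply]
        exact (hw i).le
      · simp [Function.extend_apply' _ _ _ hj]
    · rw [← hw1]
      symm
      refine Fintype.sum_of_injective f f.injective _ _ ?_ ?_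
      · intro j hj
        have hj' : ¬ ∃ i, f i = j := hj
        simp [Function.extend_apply' _ _ _ hj']
      · intro i
        simp only [f.injective.extend_apply]
    · intro j _
      by_cases hj : ∃ i, f i = j
      · obtain ⟨i, rfl⟩ := hj
        simp only [f.injective.extend_apply]
        exact hz ⟨i, rfl⟩
      · simp only [Function.extend_apply' _ _ _ hj]
        exact hz ⟨i0, rfl⟩
    · rw [← hwz]
      symm
      refine Fintype.sum_of_injective f f.injective _ _ ?_ ?_
      · intro j hj
        have hj' : ¬ ∃ i, f i = j := hj
        simp [Function.extend_apply' _ _ _ hj']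
      · intro i
        simp only [f.injective.extend_apply]
  · rintro ⟨⟨w, z⟩, ⟨hw, hz⟩, rfl⟩
    exact (convex_convexHull ℝ s).sum_mem (fun i _ => hw.1 i) hw.2
      (fun i _ => subset_convexHull ℝ s (hz i (Set.mem_univ _)))

lemma theta_nonempty (n m : ℕ) (hn : 3 ≤ n) (θ : ℝ) (hθ : 0 < θ) : ∃ (ξ : ℕ → E n) (w : ℕ → ℝ),
    (∀ i, ξ i ∈ Metric.sphere (0 : E n) 1) ∧ (∀ i, 0 ≤ w i) ∧ Summable w ∧
    (∑' i, w i) = 1 ∧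
    (∀ p ∈ P0 n m, (∑' i, w i * MvPolynomial.eval (fun j => ξ i j) p) = 0) ∧
    Summable (fun i => w i ^ θ) := by
  let B := Module.finBasis ℝ (P0sub n m)
  let X : E n → (Fin (Module.finrank ℝ (P0sub n m)) → ℝ) := fun x j => ev (B j).1 x
  have hX : Continuous X := continuous_pi fun j => ev_cont _
  have hcomp : IsCompact (convexHull ℝ (X '' sphere 0 1)) :=
    compact_hull _ ((isCompact_sphere _ _).image hX)
  have hS := SA_pos n hn
  have : NeZero (sphMeasure n) := ⟨by
    intro h0
    rw [SA, h0] at hS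
    simp at hS⟩
  have hXi : Integrable X (sphMeasure n) := by
    rw [integrable_pi_iff]
    exact fun j => int_of_cont _ (ev_cont _)
  have hmem := (convex_convexHull ℝ (X '' sphere 0 1)).average_mem (μ := sphMeasure n)
    hcomp.isClosed (f := X) (by
      filter_upwards [sph_ae n] with x hx
      exact subset_convexHull _ _ ⟨x, by simpa using hx, rfl⟩) hXi
  have h0 : ⨍ x, X x ∂(sphMeasure n) = 0 := by
    rw [average_eq]
    have : ∫ x, X x ∂(sphMeasure n) = 0 := by
      ext j
      rw [eval_integral (f := X) (fun j => int_of_cont _ (ev_cont _))]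
      exact (B j).2.2
    rw [this, smul_zero]
  rw [h0, mem_convexHull_iff_exists_fintype] at hmem
  obtain ⟨ι, _, w, z, hw, hw1, hz, hwz⟩ := hmem
  choose ζ hζ hζz using hz
  let e := Fintype.equivFin ι
  have hN : 0 < Fintype.card ι := by
    rw [Fintype.card_pos_iff]
    by_contra hc
    rw [not_nonempty_iff] at hc
    simp at hw1
  let N := Fintype.card ι
  let idx : ℕ → ι := fun i => if h : i < N then e.symm ⟨i, h⟩ else e.symm ⟨0, hN⟩
  let w' : ℕ → ℝ := fun i => if i < N then w (idx i) else 0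
  have hsupp : ∀ g : ℕ → ℝ, (∀ i, ¬ i < N → g i = 0) → HasSum g (∑ i ∈ Finset.range N, g i) := by
    intro g hg
    apply hasSum_sum_of_ne_finset_zero
    intro i hi
    exact hg i (by simpa using hi)
  have hsum : ∀ g : ι → ℝ, ∑ i ∈ Finset.range N, w' i * g (idx i) = ∑ i, w i * g i := by
    intro g
    rw [Finset.sum_range, ← Equiv.sum_comp e.symm]
    refine Finset.sum_congr rfl fun i _ => ?_
    simp [w', idx, i.2]
  have hw0 : ∀ i, ¬ i < N → w' i = 0 := fun i hi => by simp [w', hi]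
  refine ⟨fun i => ζ (idx i), w', fun i => hζ _, ?_, (hsupp w' hw0).summable, ?_, ?_, ?_⟩
  · intro i
    simp only [w']
    split_ifs
    · exact hw _
    · exact le_rfl
  · rw [(hsupp w' hw0).tsum_eq]
    have := hsum (fun _ => 1)
    simp only [mul_one] at this
    rw [this, hw1]
  · intro p hp
    rw [(hsupp (fun i => w' i * MvPolynomial.eval (fun j => ζ (idx i) j) p)
      (fun i hi => by simp [hw0 i hi])).tsum_eq]
    rw [hsum (fun i => MvPolynomial.eval (fun j => ζ i j) p)]
    have hB : ∀ j, ∑ i, w i * ev (B j).1 (ζ i) = 0 := by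
      intro j
      have := congrFun hwz j
      simp only [Finset.sum_apply, Pi.smul_apply, smul_eq_mul, Pi.zero_apply, ← hζz] at this
      exact this
    have hp' := congrArg Subtype.val (B.sum_repr ⟨p, hp⟩)
    rw [Submodule.coe_sum] at hp'
    simp only [Submodule.coe_smul] at hp'
    rw [← hp']
    simp only [map_sum, MvPolynomial.smul_eval]
    simp only [Finset.mul_sum]
    rw [Finset.sum_comm]
    apply Finset.sum_eq_zero
    intro j _
    have := hB j
    simp only [ev] at this
    calc _ = (B.repr ⟨p, hp⟩ j) * ∑ i, w i * MvPolynomial.eval (fun j => ζ i j) (B j).1 := by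
          rw [Finset.mul_sum]
          refine Finset.sum_congr rfl fun i _ => by ring
      _ = 0 := by rw [this, mul_zero]
  · exact (hsupp (fun i => w' i ^ θ) (fun i hi => by simp [hw0 i hi, hθ.ne'])).summable

lemma theta_ge_one (θ : ℝ) (hθ1 : θ < 1) (hθ0 : 0 < θ) (w : ℕ → ℝ) (hw : ∀ i, 0 ≤ w i) (hs : Summable w)
    (h1 : ∑' i, w i = 1) (hsθ : Summable fun i => w i ^ θ) : 1 ≤ ∑' i, w i ^ θ := by
  rw [← h1]
  refine hs.tsum_le_tsum (fun i => ?_) hsθ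
  have : w i ≤ 1 := by rw [← h1]; exact hs.le_tsum i fun j _ => hw j
  exact Real.self_le_rpow_of_le_one (hw i) this hθ1.le

/-- Smooth extension from a slightly larger ball. -/
lemma smooth_ext {n : ℕ} (r : ℝ) (hr : 1 < r) (v : E n → ℝ)
    (hv : ∀ x : E n, ‖x‖ < r → ContDiffAt ℝ (⊤ : ℕ∞) v x) :
    ∃ u : E n → ℝ, ContDiff ℝ (⊤ : ℕ∞) u ∧ ∀ x, ‖x‖ ≤ 1 → u x = v x := by
  let χ : ContDiffBump (0 : E n) := ⟨1, (1 + r) / 2, one_pos, by linarith⟩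
  refine ⟨fun x => χ x * v x, ?_, ?_⟩
  · rw [contDiff_iff_contDiffAt]
    intro x
    by_cases hx : ‖x‖ < r
    · exact χ.contDiffAt.mul (hv x hx)
    · have h0 : (fun x => χ x * v x) =ᶠ[nhds x] fun _ => 0 := by
        have hopen : IsOpen {y : E n | (1 + r) / 2 < ‖y‖} := isOpen_lt continuous_const continuous_norm
        filter_upwards [hopen.mem_nhds (show (1 + r) / 2 < ‖x‖ by linarith [not_lt.1 hx])] with y hy
        have : χ y = 0 := χ.zero_of_le_dist (by rw [dist_zero_right]; exact le_of_lt hy)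
        rw [this, zero_mul]
      exact contDiffAt_const.congr_of_eventuallyEq h0
  · intro x hx
    have : χ x = 1 := χ.one_of_mem_closedBall (by simpa using hx)
    simp [this]

lemma grad_sub {n : ℕ} {ι : Type*} [Fintype ι] (e : ℝ) (he : 0 < e) (he2 : e ≤ 1 / 2)
    (F : ι → E n → ℝ) (F' : ι → (E n →L[ℝ] ℝ)) (x : E n) (hF : ∀ i, HasFDerivAt (F i) (F' i) x)
    (hF0 : ∀ i, 0 ≤ F i x) (hpos : 0 < ∑ i, F i x) (γ : ι → ℝ) (hγ : ∀ i, 0 ≤ γ i)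
    (hb : ∀ i, ‖F' i‖ ≤ γ i * F i x ^ (1 - e)) :
    ‖fderiv ℝ (fun y => (∑ i, F i y) ^ e) x‖ ^ 2 ≤ e ^ 2 * ∑ i, γ i ^ 2 := by
  set S := ∑ i, F i x with hS
  have h1 : HasFDerivAt (fun y => ∑ i, F i y) (∑ i, F' i) x := HasFDerivAt.fun_sum fun i _ => hF i
  have h2 := h1.rpow_const (p := e) (Or.inl hpos.ne')
  rw [h2.fderiv, norm_smul, Real.norm_eq_abs, ← hS, abs_of_nonneg (by positivity)]
  have h3 : ‖∑ i, F' i‖ ≤ ∑ i, γ i * F i x ^ (1 - e) :=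
    (norm_sum_le _ _).trans (Finset.sum_le_sum fun i _ => hb i)
  have h4 : (∑ i, γ i * F i x ^ (1 - e)) ^ 2 ≤ (∑ i, γ i ^ 2) * ∑ i, (F i x ^ (1 - e)) ^ 2 :=
    Finset.sum_mul_sq_le_sq_mul_sq _ _ _
  have h5 : ∑ i, (F i x ^ (1 - e)) ^ 2 ≤ S ^ (2 - 2 * e) := by
    have h6 : ∀ i, (F i x ^ (1 - e)) ^ 2 ≤ F i x * S ^ (1 - 2 * e) := by
      intro i
      rw [← Real.rpow_natCast, ← Real.rpow_mul (hF0 i)]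
      have e1 : (1 - e) * ((2 : ℕ) : ℝ) = 1 + (1 - 2 * e) := by push_cast; ring
      rw [e1, Real.rpow_add_of_nonneg (hF0 i) zero_le_one (by linarith), Real.rpow_one]
      have : F i x ≤ S := Finset.single_le_sum (fun j _ => hF0 j) (Finset.mem_univ i)
      have h0 := hF0 i
      gcongr
      linarith
    calc _ ≤ ∑ i, F i x * S ^ (1 - 2 * e) := Finset.sum_le_sum fun i _ => h6 i
      _ = S * S ^ (1 - 2 * e) := by rw [← Finset.sum_mul]
      _ = S ^ (2 - 2 * e) := by
        rw [← Real.rpow_one_add' hpos.le (by linarith)]; ring_nf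
  have hc : (S ^ (e - 1)) ^ 2 * S ^ (2 - 2 * e) = 1 := by
    rw [← Real.rpow_natCast, ← Real.rpow_mul hpos.le, ← Real.rpow_add hpos]
    have : (e - 1) * ((2 : ℕ) : ℝ) + (2 - 2 * e) = 0 := by push_cast; ring
    rw [this, Real.rpow_zero]
  have hγs : 0 ≤ ∑ i, γ i ^ 2 := Finset.sum_nonneg fun i _ => sq_nonneg _
  calc (e * S ^ (e - 1) * ‖∑ i, F' i‖) ^ 2 = e ^ 2 * (S ^ (e - 1)) ^ 2 * ‖∑ i, F' i‖ ^ 2 := by ring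
    _ ≤ e ^ 2 * (S ^ (e - 1)) ^ 2 * (∑ i, γ i * F i x ^ (1 - e)) ^ 2 := by gcongr
    _ ≤ e ^ 2 * (S ^ (e - 1)) ^ 2 * ((∑ i, γ i ^ 2) * S ^ (2 - 2 * e)) := by
        gcongr
        exact h4.trans (by gcongr)
    _ = e ^ 2 * (∑ i, γ i ^ 2) * ((S ^ (e - 1)) ^ 2 * S ^ (2 - 2 * e)) := by ring
    _ = _ := by rw [hc, mul_one]


lemma dist_pos_of {n : ℕ} (r : ℝ) (hr : 1 < r) (ξ : E n) (hξ : ‖ξ‖ = 1) (x : E n) (hx : ‖x‖ < r) :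
    r - ‖x‖ ≤ ‖x - r • ξ‖ := by
  have h1 : ‖r • ξ‖ = r := by rw [norm_smul, hξ, mul_one, Real.norm_eq_abs, abs_of_pos (by linarith)]
  have := norm_sub_norm_le (r • ξ) x
  rw [norm_sub_rev, h1] at this
  exact this

lemma phi_contDiffAt {n : ℕ} (r : ℝ) (hr : 1 < r) (ξ : E n) (hξ : ‖ξ‖ = 1) (x : E n) (hx : ‖x‖ < r) :
    ContDiffAt ℝ (⊤ : ℕ∞) (phi r ξ) x := by
  have hd := dist_pos_of r hr ξ hξ x hx
  have hd' : 0 < ‖x - r • ξ‖ := by linarith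
  unfold phi bub
  refine contDiffAt_const.mul (ContDiffAt.inv ?_ (by positivity))
  exact ((contDiff_norm_sq ℝ).contDiffAt.comp x (contDiffAt_id.sub contDiffAt_const)).pow _

lemma phi_memLp (n : ℕ) (r : ℝ) (hr : 1 < r) (ξ : E n) (hξ : ‖ξ‖ = 1) :
    MemLp (phi r ξ) 2 (sphMeasure n) := by
  refine MemLp.of_bound (phi_meas r ξ).aestronglyMeasurable
    ((SA n)⁻¹ * (r^2-1)^(n-1) * (((r-1)^2)^(n-1))⁻¹) ?_
  filter_upwards [sph_ae n] with x hx
  rw [Real.norm_eq_abs, abs_of_nonneg (phi_nonneg r hr ξ x)]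
  have hd := dist_pos_of r hr ξ hξ x (by linarith)
  rw [hx] at hd
  unfold phi bub
  have h1 : 0 < r - 1 := by linarith
  have h2 : 0 ≤ r^2 - 1 := by nlinarith
  have h3 := SA_nonneg n
  gcongr

/-- The weight of a bubble in the energy estimate. -/
def gam (n : ℕ) (w r : ℝ) (ξ x : E n) : ℝ :=
  2 * ((n:ℝ) - 1) * (w * ((SA n)⁻¹ * (r^2-1)^(n-1))) ^ (((n:ℝ)-2)/(2*((n:ℝ)-1))) * (‖x - r • ξ‖^(n-1))⁻¹

lemma bubble (n : ℕ) (hn : 3 ≤ n) (r : ℝ) (hr : 1 < r) (ξ : E n) (hξ : ‖ξ‖ = 1) (w : ℝ) (hw : 0 ≤ w)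
    (x : E n) (hx : ‖x‖ < r) : ∃ F' : E n →L[ℝ] ℝ, HasFDerivAt (fun y => w * phi r ξ y) F' x ∧
      ‖F'‖ ≤ gam n w r ξ x * (w * phi r ξ x) ^ (1 - ((n:ℝ)-2)/(2*((n:ℝ)-1))) := by
  have hd := dist_pos_of r hr ξ hξ x hx
  have hd' : 0 < ‖x - r • ξ‖ := by linarith
  have hn1 : (3:ℝ) ≤ n := by exact_mod_cast hn
  set d := ‖x - r • ξ‖ with hdd
  set c := (SA n)⁻¹ * (r^2-1)^(n-1) with hc
  have h2 : 0 ≤ r^2 - 1 := by nlinarith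
  have h3 := SA_nonneg n
  have hc0 : 0 ≤ c := by positivity
  have hg : HasFDerivAt (fun y : E n => ‖y - r • ξ‖^2) (2 • (innerSL ℝ (x - r • ξ))) x := by
    have h1 : HasFDerivAt (fun y : E n => y - r • ξ) (ContinuousLinearMap.id ℝ (E n)) x :=
      (hasFDerivAt_id x).sub_const _
    exact h1.norm_sq
  have hh : HasDerivAt (fun t : ℝ => w * (c * (t^(n-1))⁻¹))
      (w * (c * (-(((n-1:ℕ):ℝ) * (d^2)^(n-1-1)) / ((d^2)^(n-1))^2))) (d^2) := by
    have := (hasDerivAt_pow (n-1) (d^2)).inv (by positivity)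
    exact (this.const_mul c).const_mul w
  have hF := hh.comp_hasFDerivAt (f := fun y : E n => ‖y - r • ξ‖^2) x hg
  refine ⟨_, hF, ?_⟩
  rw [norm_smul, Real.norm_eq_abs, abs_mul, abs_mul, abs_div, abs_neg, abs_of_nonneg hw,
    abs_of_nonneg hc0, abs_of_nonneg (by positivity), abs_of_nonneg (by positivity)]
  have hnorm : ‖(2:ℕ) • (innerSL ℝ (x - r • ξ))‖ ≤ 2 * d := by
    refine (norm_nsmul_le).trans ?_
    rw [innerSL_apply_norm]
    simp [hdd]
  set e := ((n:ℝ)-2)/(2*((n:ℝ)-1)) with he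
  have he0 : 0 < e := by apply div_pos <;> linarith
  have he1 : e < 1 := by rw [he, div_lt_one (by linarith)]; linarith
  have hphi : w * phi r ξ x = (w * c) * ((d^2)^(n-1))⁻¹ := by
    simp only [phi, bub, ← hc, ← hdd]; ring
  have hrp : (((d^2)^(n-1))⁻¹) ^ (1-e) = (d^n)⁻¹ := by
    rw [Real.inv_rpow (by positivity), ← pow_mul, ← Real.rpow_natCast, ← Real.rpow_mul hd'.le,
      ← Real.rpow_natCast d n]
    congr 2
    push_cast [Nat.cast_sub (show 1 ≤ n by omega)]
    rw [he]
    field_simp [show (n:ℝ) - 1 ≠ 0 by linarith]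
    ring
  have hC : (w*c)^e * (w*c)^(1-e) = w*c := by
    rw [← Real.rpow_add_of_nonneg (by positivity) he0.le (by linarith)]
    simp
  rw [hphi, Real.mul_rpow (by positivity) (by positivity), hrp]
  have hR : gam n w r ξ x * ((w*c)^(1-e) * (d^n)⁻¹) = 2 * ((n:ℝ)-1) * (w*c) * ((d^(n-1))⁻¹ * (d^n)⁻¹) := by
    rw [gam, ← hc, ← he, ← hdd]
    calc _ = 2 * ((n:ℝ)-1) * ((w*c)^e * (w*c)^(1-e)) * ((d^(n-1))⁻¹ * (d^n)⁻¹) := by ring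
      _ = _ := by rw [hC]
  rw [hR]
  obtain ⟨k, rfl⟩ : ∃ k, n = k + 2 := ⟨n - 2, by omega⟩
  simp only [show k + 2 - 1 = k + 1 by omega, show k + 1 - 1 = k by omega] at *
  calc _ ≤ w * (c * (((k+1:ℕ):ℝ) * (d^2)^k / ((d^2)^(k+1))^2)) * (2 * d) := by gcongr
    _ = _ := by
      push_cast
      field_simp
      ring

lemma gam_nonneg (n : ℕ) (hn : 3 ≤ n) (w r : ℝ) (hw : 0 ≤ w) (hr : 1 < r) (ξ x : E n) : 0 ≤ gam n w r ξ x := by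
  have hn1 : (3:ℝ) ≤ n := by exact_mod_cast hn
  have h2 : 0 ≤ r^2 - 1 := by nlinarith
  have h3 := SA_nonneg n
  have : (0:ℝ) ≤ n - 1 := by linarith
  unfold gam
  positivity

lemma gam_sq (n : ℕ) (hn : 3 ≤ n) (w r : ℝ) (hw : 0 ≤ w) (hr : 1 < r) (ξ x : E n) :
    (((n:ℝ)-2)/(2*((n:ℝ)-1)))^2 * gam n w r ξ x ^ 2 =
    ((n:ℝ)-2)^2 * (w * ((SA n)⁻¹ * (r^2-1)^(n-1))) ^ (((n:ℝ)-2)/((n:ℝ)-1)) * bub r ξ x := by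
  have hn1 : (3:ℝ) ≤ n := by exact_mod_cast hn
  have h2 : 0 ≤ r^2 - 1 := by nlinarith
  have h3 := SA_nonneg n
  have h4 : (n:ℝ) - 1 ≠ 0 := by linarith
  unfold gam bub
  set C := w * ((SA n)⁻¹ * (r^2-1)^(n-1)) with hC
  have hC0 : 0 ≤ C := by positivity
  have hp : (C ^ (((n:ℝ)-2)/(2*((n:ℝ)-1))))^2 = C ^ (((n:ℝ)-2)/((n:ℝ)-1)) := by
    rw [← Real.rpow_natCast, ← Real.rpow_mul hC0]
    congr 1
    push_cast
    field_simp
  rw [mul_pow, mul_pow, hp, ← pow_mul, mul_comm 2 (n-1), pow_mul, inv_pow]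
  field_simp

lemma energy_int (n : ℕ) (hn : 3 ≤ n) (w r : ℝ) (hw : 0 ≤ w) (hr : 1 < r) (ξ : E n) (hξ : ‖ξ‖ = 1) :
    ∫ x in ball (0 : E n) 1, ((n:ℝ)-2)^2 * (w * ((SA n)⁻¹ * (r^2-1)^(n-1))) ^ (((n:ℝ)-2)/((n:ℝ)-1)) * bub r ξ x
    ≤ w ^ (((n:ℝ)-2)/((n:ℝ)-1)) * (((n:ℝ)-2)/2 * SA n ^ (1/((n:ℝ)-1))) := by
  have hn1 : (3:ℝ) ≤ n := by exact_mod_cast hn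
  have h2 : 0 < r^2 - 1 := by nlinarith
  have h3 := SA_pos n hn
  have h4 : (n:ℝ) - 1 ≠ 0 := by linarith
  have h5 : (n:ℝ) - 2 ≠ 0 := by linarith
  rw [integral_const_mul]
  have hb := bub_ball_integral n hn r hr ξ hξ
  refine (mul_le_mul_of_nonneg_left hb (by positivity)).trans (le_of_eq ?_)
  rw [Real.mul_rpow hw (by positivity), Real.mul_rpow (by positivity) (by positivity)]
  have e1 : ((r^2-1)^(n-1)) ^ (((n:ℝ)-2)/((n:ℝ)-1)) = (r^2-1)^(n-2) := by
    rw [← Real.rpow_natCast, ← Real.rpow_mul h2.le, ← Real.rpow_natCast _ (n-2)]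
    congr 1
    push_cast [Nat.cast_sub (show 1 ≤ n by omega), Nat.cast_sub (show 2 ≤ n by omega)]
    field_simp
  have e2 : (SA n)⁻¹ ^ (((n:ℝ)-2)/((n:ℝ)-1)) * SA n = SA n ^ (1/((n:ℝ)-1)) := by
    rw [Real.inv_rpow h3.le, ← Real.rpow_neg h3.le, ← Real.rpow_add_one h3.ne']
    congr 1
    field_simp
    ring
  rw [e1, ← e2]
  field_simp


lemma sum_rpow_le {ι : Type*} (s : Finset ι) (f : ι → ℝ) (hf : ∀ i, 0 ≤ f i) (θ : ℝ) (h0 : 0 < θ)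
    (h1 : θ ≤ 1) : (∑ i ∈ s, f i) ^ θ ≤ ∑ i ∈ s, f i ^ θ := by
  classical
  induction s using Finset.induction_on with
  | empty => simp [h0.ne']
  | insert a s ha ih =>
    rw [Finset.sum_insert ha, Finset.sum_insert ha]
    have := Real.rpow_add_le_add_rpow (hf a) (Finset.sum_nonneg fun i (_ : i ∈ s) => hf i) h0.le h1
    linarith

lemma key (n : ℕ) (hn : 3 ≤ n) (m : ℕ) (a b : ℝ)
    (h : ∀ u : E n → ℝ, ContDiff ℝ (⊤ : ℕ∞) u →
      (∀ p ∈ P0 n m,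
        ∫ x, MvPolynomial.eval (fun i => x i) p * |u x| ^ (2 * ((n:ℝ) - 1) / ((n:ℝ) - 2))
          ∂(sphMeasure n) = 0) →
      (∫ x, |u x| ^ (2 * ((n:ℝ) - 1) / ((n:ℝ) - 2)) ∂(sphMeasure n)) ^ (((n:ℝ) - 2) / ((n:ℝ) - 1)) ≤
        a * (∫ x in Metric.ball (0 : E n) 1, ‖fderiv ℝ u x‖ ^ 2) +
          b * ∫ x, (u x) ^ 2 ∂(sphMeasure n))
    (N : ℕ) (ξ : Fin N → E n) (hξ : ∀ i, ‖ξ i‖ = 1) (w : Fin N → ℝ) (hw : ∀ i, 0 ≤ w i)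
    (r : ℝ) (hr : 1 < r) (hr2 : r < 2) (H : E n → ℝ) (hH : ContDiff ℝ (⊤ : ℕ∞) H)
    (δ M L : ℝ) (hδ : 0 < δ) (hHδ : ∀ x, ‖x‖ < 2 → δ ≤ H x) (hHM : ∀ x, ‖x‖ ≤ 1 → H x ≤ M)
    (hHL : ∀ x, ‖x‖ ≤ 1 → ‖fderiv ℝ H x‖ ≤ L)
    (hmom : ∀ p ∈ P0 n m, ∫ x, ev p x * (H x + ∑ i, w i * phi r (ξ i) x) ∂(sphMeasure n) = 0) :
    (∑ i, w i) ^ (((n:ℝ) - 2) / ((n:ℝ) - 1)) ≤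
      max a 0 * ((∑ i, w i ^ (((n:ℝ) - 2) / ((n:ℝ) - 1))) * (((n:ℝ)-2)/2 * SA n ^ (1/((n:ℝ)-1)))
        + (((n:ℝ)-2)/(2*((n:ℝ)-1)))^2 * (L / δ ^ (1 - ((n:ℝ)-2)/(2*((n:ℝ)-1))))^2 *
          (volume (ball (0 : E n) 1)).toReal)
      + |b| * (∑ i, w i ^ (((n:ℝ) - 2) / ((n:ℝ) - 1)) *
          ∫ x, phi r (ξ i) x ^ (((n:ℝ) - 2) / ((n:ℝ) - 1)) ∂(sphMeasure n)
        + M ^ (((n:ℝ) - 2) / ((n:ℝ) - 1)) * SA n) := by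
  have hn1 : (3:ℝ) ≤ n := by exact_mod_cast hn
  have hq1 : (n:ℝ) - 1 ≠ 0 := by linarith
  have hq2 : (n:ℝ) - 2 ≠ 0 := by linarith
  set θ := ((n:ℝ) - 2) / ((n:ℝ) - 1) with hθ
  set e := ((n:ℝ)-2)/(2*((n:ℝ)-1)) with he
  set q := 2 * ((n:ℝ) - 1) / ((n:ℝ) - 2) with hq
  have he0 : 0 < e := by apply div_pos <;> linarith
  have heh : e ≤ 1/2 := by rw [he, div_le_iff₀ (by linarith)]; linarith
  have hθ0 : 0 < θ := by apply div_pos <;> linarith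
  have hθ1 : θ < 1 := by rw [hθ, div_lt_one (by linarith)]; linarith
  have heq : e * q = 1 := by rw [he, hq]; field_simp
  have heθ : e * 2 = θ := by rw [he, hθ]; field_simp
  let F : Option (Fin N) → E n → ℝ := fun o => Option.elim o H (fun i y => w i * phi r (ξ i) y)
  have hFs : ∀ x, ∑ o, F o x = H x + ∑ i, w i * phi r (ξ i) x := fun x => by
    rw [Fintype.sum_option]; rfl
  have hφ0 : ∀ i x, 0 ≤ w i * phi r (ξ i) x := fun i x => mul_nonneg (hw i) (phi_nonneg r hr _ x)
  have hF0 : ∀ x, ‖x‖ < 2 → ∀ o, 0 ≤ F o x := by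
    intro x hx o
    cases o with
    | none => exact hδ.le.trans (hHδ x hx)
    | some i => exact hφ0 i x
  have hFpos : ∀ x, ‖x‖ < 2 → 0 < ∑ o, F o x := by
    intro x hx
    rw [hFs]
    have := hHδ x hx
    have := Finset.sum_nonneg fun i (_ : i ∈ Finset.univ) => hφ0 i x
    linarith
  let v : E n → ℝ := fun x => (∑ o, F o x) ^ e
  have hFc : ∀ x, ‖x‖ < r → ∀ o, ContDiffAt ℝ (⊤ : ℕ∞) (F o) x := by
    intro x hx o
    cases o with
    | none => exact hH.contDiffAt
    | some i => exact contDiffAt_const.mul (phi_contDiffAt r hr (ξ i) (hξ i) x hx)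
  obtain ⟨u, hu, huv⟩ := smooth_ext r hr v (fun x hx =>
    (ContDiffAt.sum fun o _ => hFc x hx o).rpow_const_of_ne (hFpos x (by linarith)).ne')
  have hus : ∀ᵐ x ∂(sphMeasure n), u x = v x := by
    filter_upwards [sph_ae n] with x hx using huv x hx.le
  have huq : ∀ᵐ x ∂(sphMeasure n), |u x| ^ q = H x + ∑ i, w i * phi r (ξ i) x := by
    filter_upwards [sph_ae n] with x hx
    have hp := hFpos x (by linarith)
    rw [huv x hx.le, abs_of_nonneg (Real.rpow_nonneg hp.le _), ← Real.rpow_mul hp.le, heq,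
      Real.rpow_one, hFs]
  have hmain := h u hu (by
    intro p hp
    rw [← hmom p hp]
    apply integral_congr_ae
    filter_upwards [huq] with x hx
    rw [hx]; rfl)
  have hHi : Integrable H (sphMeasure n) := int_of_cont H hH.continuous
  have hφi : ∀ i, Integrable (fun x => w i * phi r (ξ i) x) (sphMeasure n) := fun i =>
    (phi_integrable n hn r hr (ξ i) (hξ i)).const_mul _
  have hL : (∑ i, w i) ^ θ ≤ (∫ x, |u x| ^ q ∂(sphMeasure n)) ^ θ := by
    refine Real.rpow_le_rpow (Finset.sum_nonneg fun i _ => hw i) ?_ hθ0.le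
    rw [integral_congr_ae huq, integral_add hHi (integrable_finsetSum _ fun i _ => hφi i),
      integral_finsetSum _ fun i _ => hφi i]
    simp only [integral_const_mul, phi_integral n hn r hr _ (hξ _), mul_one]
    have : 0 ≤ ∫ x, H x ∂(sphMeasure n) := by
      apply integral_nonneg_of_ae
      filter_upwards [sph_ae n] with x hx
      exact hδ.le.trans (hHδ x (by linarith))
    linarith
  have hL0 : 0 ≤ L := (norm_nonneg _).trans (hHL 0 (by simp))
  set γH := L / δ ^ (1 - e) with hγH
  have hE : ∫ x in ball (0 : E n) 1, ‖fderiv ℝ u x‖ ^ 2 ≤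
      (∑ i, w i ^ θ) * (((n:ℝ)-2)/2 * SA n ^ (1/((n:ℝ)-1))) + e^2 * γH^2 * (volume (ball (0 : E n) 1)).toReal := by
    have hpt : ∀ x ∈ ball (0 : E n) 1, ‖fderiv ℝ u x‖ ^ 2 ≤ e^2 * γH^2 +
        ∑ i, ((n:ℝ)-2)^2 * (w i * ((SA n)⁻¹ * (r^2-1)^(n-1))) ^ θ * bub r (ξ i) x := by
      intro x hx
      have hx1 : ‖x‖ < 1 := by simpa using hx
      have hfd : fderiv ℝ u x = fderiv ℝ v x := by
        apply Filter.EventuallyEq.fderiv_eq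
        filter_upwards [isOpen_ball.mem_nhds hx] with y hy
        exact huv y (by have : ‖y‖ < 1 := by simpa using hy
                        exact this.le)
      have hb := fun i => bubble n hn r hr (ξ i) (hξ i) (w i) (hw i) x (by linarith)
      choose B' hB hB2 using hb
      have hx2 : ‖x‖ < 2 := by linarith
      have hg := grad_sub e he0 heh F (fun o => Option.elim o (fderiv ℝ H x) B') x (by
          intro o
          cases o with
          | none => exact (hH.differentiable (by simp) x).hasFDerivAt
          | some i => exact hB i)
        (hF0 x hx2) (hFpos x hx2) (fun o => Option.elim o γH (fun i => gam n (w i) r (ξ i) x)) (by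
          intro o
          cases o with
          | none => show 0 ≤ γH; positivity
          | some i => exact gam_nonneg n hn _ r (hw i) hr _ _) (by
          intro o
          cases o with
          | none =>
            show ‖fderiv ℝ H x‖ ≤ γH * H x ^ (1 - e)
            have hd : 0 < δ ^ (1 - e) := by positivity
            calc _ ≤ L := hHL x hx1.le
              _ = γH * δ ^ (1 - e) := by rw [hγH]; field_simp
              _ ≤ _ := by
                have hd2 : 0 ≤ γH := by positivity
                exact mul_le_mul_of_nonneg_left
                  (Real.rpow_le_rpow hδ.le (hHδ x hx2) (by linarith)) hd2
          | some i => exact hB2 i)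
      rw [hfd]
      refine hg.trans (le_of_eq ?_)
      rw [Fintype.sum_option]
      simp only [Option.elim]
      rw [mul_add, Finset.mul_sum]
      congr 1
      refine Finset.sum_congr rfl fun i _ => gam_sq n hn (w i) r (hw i) hr (ξ i) x
    have hbi : ∀ i, IntegrableOn (fun x => ((n:ℝ)-2)^2 * (w i * ((SA n)⁻¹ * (r^2-1)^(n-1))) ^ θ * bub r (ξ i) x)
        (ball (0 : E n) 1) := fun i => (bub_ball_integrable n hn r hr (ξ i) (hξ i)).const_mul _
    have hci : IntegrableOn (fun _ : E n => e^2 * γH^2) (ball (0 : E n) 1) :=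
      integrableOn_const measure_ball_lt_top.ne
    calc _ ≤ ∫ x in ball (0 : E n) 1, (e^2 * γH^2 +
        ∑ i, ((n:ℝ)-2)^2 * (w i * ((SA n)⁻¹ * (r^2-1)^(n-1))) ^ θ * bub r (ξ i) x) := by
          refine integral_mono_of_nonneg (Eventually.of_forall fun x => by positivity)
            (hci.add (integrable_finsetSum _ fun i _ => hbi i)) ?_
          filter_upwards [ae_restrict_mem measurableSet_ball] with x hx using hpt x hx
      _ = e^2 * γH^2 * (volume (ball (0 : E n) 1)).toReal +
          ∑ i, ∫ x in ball (0 : E n) 1, ((n:ℝ)-2)^2 * (w i * ((SA n)⁻¹ * (r^2-1)^(n-1))) ^ θ * bub r (ξ i) x := by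
          rw [integral_add hci (integrable_finsetSum _ fun i _ => hbi i),
            integral_finsetSum _ fun i _ => hbi i]
          congr 1
          rw [setIntegral_const, smul_eq_mul, mul_comm]; rfl
      _ ≤ e^2 * γH^2 * (volume (ball (0 : E n) 1)).toReal +
          ∑ i, w i ^ θ * (((n:ℝ)-2)/2 * SA n ^ (1/((n:ℝ)-1))) := by
          gcongr with i _
          exact energy_int n hn (w i) r (hw i) hr (ξ i) (hξ i)
      _ = _ := by rw [Finset.sum_mul]; ring
  have h2 : ∫ x, (u x) ^ 2 ∂(sphMeasure n) ≤ ∑ i, w i ^ θ * ∫ x, phi r (ξ i) x ^ θ ∂(sphMeasure n)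
        + M ^ θ * SA n := by
    have hpi : ∀ i, Integrable (fun x => w i ^ θ * phi r (ξ i) x ^ θ) (sphMeasure n) := fun i =>
      (phi_rpow_integrable n hn (ξ i) (hξ i) r hr θ hθ0 hθ1).const_mul _
    calc _ ≤ ∫ x, (∑ i, w i ^ θ * phi r (ξ i) x ^ θ + M ^ θ) ∂(sphMeasure n) := by
          refine integral_mono_of_nonneg (Eventually.of_forall fun x => by positivity)
            ((integrable_finsetSum _ fun i _ => hpi i).add (integrable_const _)) ?_
          filter_upwards [sph_ae n] with x hx
          have hx2 : ‖x‖ < 2 := by linarith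
          rw [huv x hx.le, ← Real.rpow_natCast, ← Real.rpow_mul (hFpos x hx2).le]
          push_cast
          rw [heθ]
          refine (sum_rpow_le _ (fun o => F o x) (hF0 x hx2) θ hθ0 hθ1.le).trans ?_
          rw [Fintype.sum_option, add_comm]
          refine add_le_add (le_of_eq (Finset.sum_congr rfl fun i _ => ?_)) ?_
          · exact Real.mul_rpow (hw i) (phi_nonneg r hr _ x)
          · exact Real.rpow_le_rpow (hF0 x hx2 none) (hHM x hx.le) hθ0.le
      _ = _ := by
          rw [integral_add (integrable_finsetSum _ fun i _ => hpi i) (integrable_const _),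
            integral_finsetSum _ fun i _ => hpi i]
          simp only [integral_const_mul, integral_const, smul_eq_mul]
          rw [mul_comm (M ^ θ)]; rfl
  have hE0 : 0 ≤ ∫ x in ball (0 : E n) 1, ‖fderiv ℝ u x‖ ^ 2 := integral_nonneg fun x => by positivity
  have h20 : 0 ≤ ∫ x, (u x) ^ 2 ∂(sphMeasure n) := integral_nonneg fun x => by positivity
  calc _ ≤ _ := hL
    _ ≤ _ := hmain
    _ ≤ max a 0 * (∫ x in ball (0 : E n) 1, ‖fderiv ℝ u x‖ ^ 2) + |b| * ∫ x, (u x) ^ 2 ∂(sphMeasure n) := by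
      gcongr
      · exact le_max_left _ _
      · exact le_abs_self b
    _ ≤ _ := by
      gcongr


lemma bound_polys {n K : ℕ} (P : Fin K → MvPolynomial (Fin n) ℝ) : ∃ A : ℝ, 0 < A ∧
    ∀ x : E n, ‖x‖ ≤ 2 → ∑ k, |ev (P k) x| ≤ A / 2 ∧ ∑ k, ‖fderiv ℝ (ev (P k)) x‖ ≤ A := by
  have hK : IsCompact (closedBall (0 : E n) 2) := isCompact_closedBall _ _
  have c1 : Continuous fun x : E n => ∑ k, |ev (P k) x| :=
    continuous_finsetSum _ fun k _ => (ev_cont (P k)).abs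
  have c2 : Continuous fun x : E n => ∑ k, ‖fderiv ℝ (ev (P k)) x‖ :=
    continuous_finsetSum _ fun k _ => ((ev_contDiff (P k)).continuous_fderiv (by simp)).norm
  obtain ⟨B1, h1⟩ := hK.exists_bound_of_continuousOn c1.continuousOn
  obtain ⟨B2, h2⟩ := hK.exists_bound_of_continuousOn c2.continuousOn
  refine ⟨2 * |B1| + |B2| + 1, by positivity, fun x hx => ?_⟩
  have g1 := (le_abs_self _).trans (h1 x (by simpa using hx))
  have g2 := (le_abs_self _).trans (h2 x (by simpa using hx))
  have := le_abs_self B1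
  have := le_abs_self B2
  have := abs_nonneg B1
  have := abs_nonneg B2
  constructor <;> linarith

lemma approx (n : ℕ) (hn : 3 ≤ n) (m : ℕ) (a b : ℝ)
    (h : ∀ u : E n → ℝ, ContDiff ℝ (⊤ : ℕ∞) u →
      (∀ p ∈ P0 n m,
        ∫ x, MvPolynomial.eval (fun i => x i) p * |u x| ^ (2 * ((n:ℝ) - 1) / ((n:ℝ) - 2))
          ∂(sphMeasure n) = 0) →
      (∫ x, |u x| ^ (2 * ((n:ℝ) - 1) / ((n:ℝ) - 2)) ∂(sphMeasure n)) ^ (((n:ℝ) - 2) / ((n:ℝ) - 1)) ≤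
        a * (∫ x in Metric.ball (0 : E n) 1, ‖fderiv ℝ u x‖ ^ 2) +
          b * ∫ x, (u x) ^ 2 ∂(sphMeasure n))
    (ξ : ℕ → E n) (w : ℕ → ℝ)
    (hξ : ∀ i, ξ i ∈ Metric.sphere (0 : E n) 1) (hw : ∀ i, 0 ≤ w i) (hws : Summable w)
    (hw1 : (∑' i, w i) = 1)
    (hm : ∀ p ∈ P0 n m, (∑' i, w i * MvPolynomial.eval (fun j => ξ i j) p) = 0)
    (hwθ : Summable (fun i => w i ^ (((n:ℝ) - 2) / ((n:ℝ) - 1)))) (η : ℝ) (hη : 0 < η) (hη1 : η < 1) :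
    (1 - η) ^ (((n:ℝ) - 2) / ((n:ℝ) - 1)) ≤
      max a 0 * ((∑' i, w i ^ (((n:ℝ) - 2) / ((n:ℝ) - 1))) * (((n:ℝ)-2)/2 * SA n ^ (1/((n:ℝ)-1))) + η)
        + |b| * (η + η) := by
  have hn1 : (3:ℝ) ≤ n := by exact_mod_cast hn
  have hK := key n hn m a b h
  set θ := ((n:ℝ) - 2) / ((n:ℝ) - 1) with hθ
  set e := ((n:ℝ)-2)/(2*((n:ℝ)-1)) with he
  have he0 : 0 < e := by apply div_pos <;> linarith
  have heh : e ≤ 1/2 := by rw [he, div_le_iff₀ (by linarith)]; linarith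
  have hθ0 : 0 < θ := by apply div_pos <;> linarith
  have hθ1 : θ < 1 := by rw [hθ, div_lt_one (by linarith)]; linarith
  have hξ1 : ∀ i, ‖ξ i‖ = 1 := fun i => by simpa using hξ i
  obtain ⟨K, P, hP, hgram⟩ := gram n m
  obtain ⟨A, hA, hAb⟩ := bound_polys P
  -- choice of the scale s
  obtain ⟨s, hs0, hs1, hs2⟩ : ∃ s : ℝ, 0 < s ∧
      e^2 * (2 * s ^ e)^2 * (volume (ball (0 : E n) 1)).toReal < η ∧ (3 * s) ^ θ * SA n < η := by
    have t1 : Tendsto (fun s : ℝ => e^2 * (2 * s ^ e)^2 * (volume (ball (0 : E n) 1)).toReal)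
        (nhdsWithin 0 (Set.Ioi 0)) (nhds 0) := by
      have hc : Continuous (fun s : ℝ => e^2 * (2 * s ^ e)^2 * (volume (ball (0 : E n) 1)).toReal) := by
        have := Real.continuous_rpow_const he0.le
        fun_prop
      have := hc.tendsto 0
      simp only [Real.zero_rpow he0.ne'] at this
      simp only [mul_zero, ne_eq, OfNat.ofNat_ne_zero, not_false_eq_true, zero_pow, zero_mul] at this
      exact this.mono_left nhdsWithin_le_nhds
    have t2 : Tendsto (fun s : ℝ => (3 * s) ^ θ * SA n) (nhdsWithin 0 (Set.Ioi 0)) (nhds 0) := by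
      have hc : Continuous (fun s : ℝ => (3 * s) ^ θ * SA n) := by
        have := (Real.continuous_rpow_const hθ0.le).comp (continuous_const.mul continuous_id : Continuous fun s : ℝ => 3 * s)
        exact this.mul continuous_const
      have := hc.tendsto 0
      simp only [mul_zero, Real.zero_rpow hθ0.ne', zero_mul] at this
      exact this.mono_left nhdsWithin_le_nhds
    have := (self_mem_nhdsWithin (a := (0:ℝ)) (s := Set.Ioi 0))
    obtain ⟨s, ⟨h1, h2⟩, h3⟩ := (((t1.eventually (gt_mem_nhds hη)).and (t2.eventually (gt_mem_nhds hη))).and this).exists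
    exact ⟨s, h3, h1, h2⟩
  set ε := 2 * s / A with hε
  have hε0 : 0 < ε := by positivity
  -- choice of N
  have hPs : ∀ k, HasSum (fun i => w i * ev (P k) (ξ i)) 0 := by
    intro k
    have hsum : Summable (fun i => w i * ev (P k) (ξ i)) := by
      refine Summable.of_norm_bounded (hws.mul_right (A/2)) fun i => ?_
      rw [norm_mul, Real.norm_eq_abs, Real.norm_eq_abs, abs_of_nonneg (hw i)]
      refine mul_le_mul_of_nonneg_left ?_ (hw i)
      refine le_trans ?_ (hAb (ξ i) (by rw [hξ1]; norm_num)).1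
      exact Finset.single_le_sum (f := fun k => |ev (P k) (ξ i)|) (fun _ _ => abs_nonneg _) (Finset.mem_univ k)
    have := hsum.hasSum
    rwa [show ∑' i, w i * ev (P k) (ξ i) = 0 from hm (P k) (hP k)] at this
  obtain ⟨N, hN1, hN2⟩ : ∃ N : ℕ, 1 - η < ∑ i ∈ Finset.range N, w i ∧
      ∀ k, |∑ i ∈ Finset.range N, w i * ev (P k) (ξ i)| < ε := by
    have t1 : Tendsto (fun N => ∑ i ∈ Finset.range N, w i) atTop (nhds 1) := by
      rw [← hw1]; exact hws.hasSum.tendsto_sum_nat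
    have t2 : ∀ k, ∀ᶠ N in atTop, |∑ i ∈ Finset.range N, w i * ev (P k) (ξ i)| < ε := by
      intro k
      have := (hPs k).tendsto_sum_nat.abs
      rw [abs_zero] at this
      exact this.eventually (gt_mem_nhds hε0)
    exact ((t1.eventually (lt_mem_nhds (by linarith))).and (eventually_all.2 t2)).exists
  -- choice of r
  let Φ : ℝ → E n → ℝ := fun r x => ∑ i : Fin N, w i * phi r (ξ i) x
  have hΦint : ∀ (p : E n → ℝ), Continuous p → ∀ r, 1 < r → ∫ x, p x * Φ r x ∂(sphMeasure n) =
      ∑ i : Fin N, w i * ∫ x, p x * phi r (ξ i) x ∂(sphMeasure n) := by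
    intro p hp r hr
    have hi : ∀ i : Fin N, Integrable (fun x => p x * phi r (ξ i) x) (sphMeasure n) := fun i =>
      (memLp_of_cont p hp 2).integrable_mul (phi_memLp n r hr (ξ i) (hξ1 i))
    simp only [Φ, Finset.mul_sum]
    have : ∀ x, (∑ i : Fin N, p x * (w i * phi r (ξ i) x)) = ∑ i : Fin N, w i * (p x * phi r (ξ i) x) :=
      fun x => Finset.sum_congr rfl fun i _ => by ring
    simp only [this]
    rw [integral_finsetSum _ fun i _ => (hi i).const_mul _]
    simp only [integral_const_mul]
  obtain ⟨r, hr, hr2, hre, hrL⟩ : ∃ r : ℝ, 1 < r ∧ r < 2 ∧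
      (∀ k, |∫ x, ev (P k) x * Φ r x ∂(sphMeasure n)| < ε) ∧
      ∑ i : Fin N, w i ^ θ * ∫ x, phi r (ξ i) x ^ θ ∂(sphMeasure n) < η := by
    have t1 : ∀ k, ∀ᶠ r in nhdsWithin 1 (Set.Ioi 1), |∫ x, ev (P k) x * Φ r x ∂(sphMeasure n)| < ε := by
      intro k
      have t : Tendsto (fun r => ∑ i : Fin N, w i * ∫ x, ev (P k) x * phi r (ξ i) x ∂(sphMeasure n))
          (nhdsWithin 1 (Set.Ioi 1)) (nhds (∑ i : Fin N, w i * ev (P k) (ξ i))) :=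
        tendsto_finsetSum _ fun i _ => (phi_conc n hn (ξ i) (hξ1 i) _ (ev_cont (P k))).const_mul _
      have hlt := hN2 k
      rw [Finset.sum_range] at hlt
      filter_upwards [t.abs.eventually (gt_mem_nhds hlt), self_mem_nhdsWithin] with r h1 h2
      rw [hΦint _ (ev_cont (P k)) r h2]
      exact h1
    have t2 : Tendsto (fun r => ∑ i : Fin N, w i ^ θ * ∫ x, phi r (ξ i) x ^ θ ∂(sphMeasure n))
        (nhdsWithin 1 (Set.Ioi 1)) (nhds 0) := by
      have := tendsto_finsetSum (Finset.univ : Finset (Fin N)) fun i _ =>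
        (phi_L2 n hn (ξ i) (hξ1 i) θ hθ0 hθ1).const_mul (w i ^ θ)
      simpa using this
    have t3 : ∀ᶠ r : ℝ in nhdsWithin 1 (Set.Ioi 1), r < 2 :=
      nhdsWithin_le_nhds (gt_mem_nhds (by norm_num))
    have t4 : ∀ᶠ r : ℝ in nhdsWithin 1 (Set.Ioi 1), 1 < r := self_mem_nhdsWithin
    obtain ⟨r, ⟨⟨h1, h2⟩, h3⟩, h4⟩ :=
      ((t4.and t3).and (eventually_all.2 t1)).and (t2.eventually (gt_mem_nhds hη)) |>.exists
    exact ⟨r, h1, h2, h3, h4⟩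
  -- the corrector
  let c : Fin K → ℝ := fun k => ∫ x, ev (P k) x * Φ r x ∂(sphMeasure n)
  let H : E n → ℝ := fun x => 2 * s - ∑ k, c k * ev (P k) x
  have hcs : ∀ x : E n, ‖x‖ ≤ 2 → |∑ k, c k * ev (P k) x| ≤ s := by
    intro x hx
    calc _ ≤ ∑ k, |c k * ev (P k) x| := Finset.abs_sum_le_sum_abs _ _
      _ ≤ ∑ k, ε * |ev (P k) x| := by
        gcongr with k
        rw [abs_mul]
        exact mul_le_mul_of_nonneg_right (hre k).le (abs_nonneg _)
      _ = ε * ∑ k, |ev (P k) x| := by rw [Finset.mul_sum]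
      _ ≤ ε * (A / 2) := by gcongr; exact (hAb x hx).1
      _ = s := by rw [hε]; field_simp
  have hHc : ContDiff ℝ (⊤ : ℕ∞) H :=
    contDiff_const.sub (ContDiff.sum fun k _ => contDiff_const.mul (ev_contDiff (P k)))
  have hΦm : MemLp (Φ r) 2 (sphMeasure n) :=
    memLp_finsetSum _ fun i _ => (phi_memLp n r hr (ξ i) (hξ1 i)).const_mul (w i)
  have hfin := hK N (fun i => ξ i) (fun i => hξ1 i) (fun i => w i) (fun i => hw i) r hr hr2 H hHc
    s (3 * s) (2 * s) hs0
    (fun x hx => by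
      have := (abs_le.1 (hcs x hx.le)).2
      simp only [H]; linarith)
    (fun x hx => by
      have := (abs_le.1 (hcs x (by linarith))).1
      simp only [H]; linarith)
    (fun x hx => by
      have hd : HasFDerivAt H (-∑ k, c k • fderiv ℝ (ev (P k)) x) x := by
        refine HasFDerivAt.const_sub (HasFDerivAt.fun_sum fun k _ => ?_) _
        exact (((ev_contDiff (P k)).differentiable (by simp)) x).hasFDerivAt.const_mul _
      rw [hd.fderiv, norm_neg]
      calc _ ≤ ∑ k, ‖c k • fderiv ℝ (ev (P k)) x‖ := norm_sum_le _ _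
        _ ≤ ∑ k, ε * ‖fderiv ℝ (ev (P k)) x‖ := by
          gcongr with k
          rw [norm_smul]
          exact mul_le_mul_of_nonneg_right (hre k).le (norm_nonneg _)
        _ = ε * ∑ k, ‖fderiv ℝ (ev (P k)) x‖ := by rw [Finset.mul_sum]
        _ ≤ ε * A := by gcongr; exact (hAb x (by linarith)).2
        _ = 2 * s := by rw [hε]; field_simp)
    (fun p hp => by
      have i0 : Integrable (fun x => ev p x * (2 * s)) (sphMeasure n) :=
        (int_of_cont _ (ev_cont p)).mul_const _
      have i1 : ∀ k, Integrable (fun x => c k * (ev p x * ev (P k) x)) (sphMeasure n) := fun k =>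
        (int_of_cont _ ((ev_cont p).mul (ev_cont (P k)))).const_mul _
      have i2 : Integrable (fun x => ev p x * Φ r x) (sphMeasure n) :=
        (memLp_of_cont _ (ev_cont p) 2).integrable_mul hΦm
      have hx : ∀ x, ev p x * (H x + ∑ i : Fin N, w i * phi r (ξ i) x) =
          ev p x * (2 * s) - (∑ k, c k * (ev p x * ev (P k) x)) + ev p x * Φ r x := by
        intro x
        simp only [H, Φ]
        rw [mul_add, mul_sub, Finset.mul_sum (f := fun k => c k * ev (P k) x)]
        congr 2
        exact Finset.sum_congr rfl fun k _ => by ring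
      simp only [hx]
      have i3 : Integrable (fun x => ∑ k, c k * (ev p x * ev (P k) x)) (sphMeasure n) :=
        integrable_finsetSum _ fun k _ => i1 k
      have i4 : Integrable (fun x => ev p x * (2 * s) - ∑ k, c k * (ev p x * ev (P k) x)) (sphMeasure n) :=
        i0.sub i3
      rw [integral_add i4 i2, integral_sub i0 i3, integral_finsetSum _ fun k _ => i1 k,
        integral_mul_const, show ∫ x, ev p x ∂(sphMeasure n) = 0 from hp.2, hgram _ hΦm p hp]
      simp only [integral_const_mul, c]
      ring)
  rw [← Finset.sum_range, ← Finset.sum_range (fun i => w i ^ θ)] at hfin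
  have hsc : 2 * s / s ^ (1 - e) = 2 * s ^ e := by
    have : s = s ^ e * s ^ (1 - e) := by rw [← Real.rpow_add hs0]; simp
    have h1 : 0 < s ^ (1 - e) := by positivity
    rw [div_eq_iff h1.ne', mul_assoc, ← this]
  rw [hsc] at hfin
  have hTs : ∑ i ∈ Finset.range N, w i ^ θ ≤ ∑' i, w i ^ θ :=
    hwθ.sum_le_tsum _ fun i _ => Real.rpow_nonneg (hw i) _
  have hKK : 0 ≤ ((n:ℝ)-2)/2 * SA n ^ (1/((n:ℝ)-1)) := by
    have := SA_nonneg n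
    have : (0:ℝ) ≤ n - 2 := by linarith
    positivity
  calc (1 - η) ^ θ ≤ (∑ i ∈ Finset.range N, w i) ^ θ :=
        Real.rpow_le_rpow (by linarith) hN1.le hθ0.le
    _ ≤ _ := hfin
    _ ≤ _ := by gcongr


theorem stmt2 (n : ℕ) (hn : 3 ≤ n) (m : ℕ) (a b : ℝ)
    (h : ∀ u : E n → ℝ, ContDiff ℝ (⊤ : ℕ∞) u →
      (∀ p ∈ P0 n m,
        ∫ x, MvPolynomial.eval (fun i => x i) p * |u x| ^ (2 * ((n:ℝ) - 1) / ((n:ℝ) - 2))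
          ∂(sphMeasure n) = 0) →
      (∫ x, |u x| ^ (2 * ((n:ℝ) - 1) / ((n:ℝ) - 2)) ∂(sphMeasure n)) ^ (((n:ℝ) - 2) / ((n:ℝ) - 1)) ≤
        a * (∫ x in Metric.ball (0 : E n) 1, ‖fderiv ℝ u x‖ ^ 2) +
          b * ∫ x, (u x) ^ 2 ∂(sphMeasure n)) :
    (2 / ((n:ℝ) - 2)) * SA n ^ (-(1 / ((n:ℝ) - 1))) / Theta n m (((n:ℝ) - 2) / ((n:ℝ) - 1)) ≤ a := by
  have hn1 : (3:ℝ) ≤ n := by exact_mod_cast hn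
  have hap := approx n hn m a b h
  have hne := theta_nonempty n m hn (((n:ℝ) - 2) / ((n:ℝ) - 1)) (by apply div_pos <;> linarith)
  set θ := ((n:ℝ) - 2) / ((n:ℝ) - 1) with hθ
  have hθ0 : 0 < θ := by apply div_pos <;> linarith
  have hθ1 : θ < 1 := by rw [hθ, div_lt_one (by linarith)]; linarith
  have hS := SA_pos n hn
  set κ := ((n:ℝ)-2)/2 * SA n ^ (1/((n:ℝ)-1)) with hκ
  have hn2 : (0:ℝ) < n - 2 := by linarith
  have hκ0 : 0 < κ := by positivity
  have hcst : (2 / ((n:ℝ) - 2)) * SA n ^ (-(1 / ((n:ℝ) - 1))) = κ⁻¹ := by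
    rw [hκ, Real.rpow_neg hS.le, mul_inv, inv_div]
  rw [hcst]
  have hone : ∀ t ∈ {t : ℝ | ∃ (ξ : ℕ → E n) (w : ℕ → ℝ),
    (∀ i, ξ i ∈ Metric.sphere (0 : E n) 1) ∧ (∀ i, 0 ≤ w i) ∧ Summable w ∧
    (∑' i, w i) = 1 ∧
    (∀ p ∈ P0 n m, (∑' i, w i * MvPolynomial.eval (fun j => ξ i j) p) = 0) ∧
    Summable (fun i => w i ^ θ) ∧ t = ∑' i, w i ^ θ}, 1 ≤ t ∧ 1 ≤ max a 0 * (t * κ) := by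
    rintro t ⟨ξ, w, hξ, hw, hws, hw1, hm, hwθ, rfl⟩
    refine ⟨theta_ge_one θ hθ1 hθ0 w hw hws hw1 hwθ, ?_⟩
    have hev : ∀ᶠ η : ℝ in nhdsWithin 0 (Set.Ioi 0), (1 - η) ^ θ ≤
        max a 0 * ((∑' i, w i ^ θ) * κ + η) + |b| * (η + η) := by
      have h1 : ∀ᶠ η : ℝ in nhdsWithin 0 (Set.Ioi 0), η < 1 :=
        nhdsWithin_le_nhds (gt_mem_nhds (by norm_num))
      filter_upwards [h1, self_mem_nhdsWithin] with η h2 h3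
      exact hap ξ w hξ hw hws hw1 hm hwθ η h3 h2
    have t1 : Tendsto (fun η : ℝ => (1 - η) ^ θ) (nhdsWithin 0 (Set.Ioi 0)) (nhds 1) := by
      have hc : Continuous (fun η : ℝ => (1 - η) ^ θ) :=
        (Real.continuous_rpow_const hθ0.le).comp (continuous_const.sub continuous_id)
      have := hc.tendsto 0
      simp only [sub_zero, Real.one_rpow] at this
      exact this.mono_left nhdsWithin_le_nhds
    have t2 : Tendsto (fun η : ℝ => max a 0 * ((∑' i, w i ^ θ) * κ + η) + |b| * (η + η))
        (nhdsWithin 0 (Set.Ioi 0)) (nhds (max a 0 * ((∑' i, w i ^ θ) * κ))) := by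
      have hc : Continuous (fun η : ℝ => max a 0 * ((∑' i, w i ^ θ) * κ + η) + |b| * (η + η)) := by
        fun_prop
      have := hc.tendsto 0
      simp only [add_zero, mul_zero] at this
      exact this.mono_left nhdsWithin_le_nhds
    exact le_of_tendsto_of_tendsto t1 t2 hev
  obtain ⟨ξ, w, h1, h2, h3, h4, h5, h6⟩ := hne
  have hset : (∑' i, w i ^ θ) ∈ {t : ℝ | ∃ (ξ : ℕ → E n) (w : ℕ → ℝ),
    (∀ i, ξ i ∈ Metric.sphere (0 : E n) 1) ∧ (∀ i, 0 ≤ w i) ∧ Summable w ∧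
    (∑' i, w i) = 1 ∧
    (∀ p ∈ P0 n m, (∑' i, w i * MvPolynomial.eval (fun j => ξ i j) p) = 0) ∧
    Summable (fun i => w i ^ θ) ∧ t = ∑' i, w i ^ θ} := ⟨ξ, w, h1, h2, h3, h4, h5, h6, rfl⟩
  have ha : 0 < a := by
    by_contra hc
    have := (hone _ hset).2
    rw [max_eq_right (not_lt.1 hc), zero_mul] at this
    linarith
  have hge1 : 1 ≤ Theta n m θ := le_csInf ⟨_, hset⟩ fun t ht => (hone t ht).1
  have hge2 : (a * κ)⁻¹ ≤ Theta n m θ := by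
    refine le_csInf ⟨_, hset⟩ fun t ht => ?_
    have := (hone t ht).2
    rw [max_eq_left ha.le] at this
    rw [inv_le_iff_one_le_mul₀ (by positivity)]
    linarith
  rw [div_le_iff₀ (by linarith)]
  rw [inv_le_iff_one_le_mul₀ (by positivity)] at hge2 ⊢
  linarith
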